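/- arXiv:2510.08751 — 5 statements merged into one kernel-verified Lean document; each statement's English description precedes it below -/
import Mathlib

section
/- Assume det A = 0, tr A = 0, ω(Aζ, ζ) ≠ 0 (the Lie algebra rank condition) and ω(Aζ, θη) ≠ 0 (the ad-rank condition). Then the whole group ℍ = ℝ² × ℝ is a control set of Σ_ℍ, and it is the only control set of Σ_ℍ. -/
open Set Matrix

noncomputable section

/-- Vectors in the plane. -/
abbrev V2 := Fin 2 → ℝ

/-- The standard symplectic form on `ℝ²`: `ω(v,w) = v₁w₂ − v₂w₁`. -/
def omega2 (v w : V2) : ℝ := v 0 * w 1 - v 1 * w 0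

/-- Counterclockwise rotation by `π/2`. -/
def theta (v : V2) : V2 := ![-(v 1), v 0]

/-- `u` is piecewise constant on `[0,∞)`: on every interval `[0,T]` it is a finite
step function (right-continuous convention). -/
def PiecewiseConst (u : ℝ → ℝ) : Prop :=
  ∀ T : ℝ, 0 ≤ T → ∃ (n : ℕ) (τ : ℕ → ℝ), τ 0 = 0 ∧ StrictMono τ ∧ T ≤ τ n ∧
    ∀ i < n, ∀ s ∈ Ico (τ i) (τ (i + 1)), u s = u (τ i)

/-- Admissible controls: piecewise constant functions with values in `Ω`. -/
def Admissible (Ω : Set ℝ) (u : ℝ → ℝ) : Prop :=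
  (∀ t, u t ∈ Ω) ∧ PiecewiseConst u

/-- `x` is a trajectory of the control system `ẋ = f(u(t), x)` on `[0,∞)`
with control `u`. -/
def IsTraj {M : Type*} [NormedAddCommGroup M] [NormedSpace ℝ M]
    (f : ℝ → M → M) (u : ℝ → ℝ) (x : ℝ → M) : Prop :=
  ContinuousOn x (Ici 0) ∧
    ∀ t ∈ Ici (0 : ℝ), HasDerivWithinAt x (f (u t) (x t)) (Ici t) t

/-- The positive orbit `O⁺(p)` of the control system `f` with control range `Ω`. -/
def PosOrbit {M : Type*} [NormedAddCommGroup M] [NormedSpace ℝ M]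
    (f : ℝ → M → M) (Ω : Set ℝ) (p : M) : Set M :=
  {q | ∃ (u : ℝ → ℝ) (x : ℝ → M) (T : ℝ), Admissible Ω u ∧ IsTraj f u x ∧
    x 0 = p ∧ 0 ≤ T ∧ x T = q}

/-- The two defining properties of a control set: (i) for every `p ∈ C` there is an
admissible control keeping the trajectory in `C` for all positive times;
(ii) `C ⊆ cl O⁺(p)` for all `p ∈ C`.  (Nonemptiness is also required.) -/
def ControlSetProp {M : Type*} [NormedAddCommGroup M] [NormedSpace ℝ M]
    (f : ℝ → M → M) (Ω : Set ℝ) (C : Set M) : Prop :=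
  C.Nonempty ∧
  (∀ p ∈ C, ∃ (u : ℝ → ℝ) (x : ℝ → M), Admissible Ω u ∧ IsTraj f u x ∧ x 0 = p ∧
      ∀ t : ℝ, 0 ≤ t → x t ∈ C) ∧
  (∀ p ∈ C, C ⊆ closure (PosOrbit f Ω p))

/-- A control set: a set satisfying `ControlSetProp`, maximal w.r.t. set inclusion
among such sets. -/
def IsControlSet {M : Type*} [NormedAddCommGroup M] [NormedSpace ℝ M]
    (f : ℝ → M → M) (Ω : Set ℝ) (C : Set M) : Prop :=
  ControlSetProp f Ω C ∧ ∀ C', ControlSetProp f Ω C' → C ⊆ C' → C = C'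

/-- The right-hand side of the linear control system `Σ_ℍ` on the Heisenberg group
`ℍ = ℝ² × ℝ`:  `v̇ = Av + uζ`, `ż = (tr A) z + uα + ω(v, θη + (u/2)ζ)`. -/
def heisF (A : Matrix (Fin 2) (Fin 2) ℝ) (η ζ : V2) (α : ℝ) (u : ℝ)
    (p : V2 × ℝ) : V2 × ℝ :=
  (A.mulVec p.1 + u • ζ,
    A.trace * p.2 + u * α + omega2 p.1 (theta η + (u / 2) • ζ))

/-- The right-hand side of the planar linear control system `v̇ = Av + uζ`. -/
def planF (A : Matrix (Fin 2) (Fin 2) ℝ) (ζ : V2) (u : ℝ) (v : V2) : V2 :=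
  A.mulVec v + u • ζ

/-- The derivation `𝒟(v,z) = (Av, ω(v,θη) + (tr A) z)` of the Heisenberg Lie
algebra associated to the drift of `Σ_ℍ`. -/
def Dmap (A : Matrix (Fin 2) (Fin 2) ℝ) (η : V2) (p : V2 × ℝ) : V2 × ℝ :=
  (A.mulVec p.1, omega2 p.1 (theta η) + A.trace * p.2)

theorem piecewiseConst_const (c : ℝ) : PiecewiseConst fun _ => c := by
  intro T _
  obtain ⟨n, hn⟩ := exists_nat_ge T
  exact ⟨n, fun i => i, by simp, Nat.strictMono_cast, hn, fun _ _ _ _ => rfl⟩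

theorem PiecewiseConst.prepend {u : ℝ → ℝ} (hu : PiecewiseConst u) (c : ℝ) {t : ℝ} (ht : 0 < t) :
    PiecewiseConst fun s => if s < t then c else u (s - t) := by
  intro T _
  obtain ⟨n, τ, h0, hmono, hT, hconst⟩ := hu (max (T - t) 0) (le_max_right _ _)
  have hnonneg (i : ℕ) : 0 ≤ τ i := h0 ▸ hmono.monotone (Nat.zero_le i)
  refine ⟨n + 1, fun i => Nat.casesOn i 0 fun j => τ j + t, rfl, ?_, ?_, ?_⟩
  · refine strictMono_nat_of_lt_succ fun i => ?_
    cases i with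
    | zero => simpa [h0] using ht
    | succ j => simpa using hmono (Nat.lt_succ_self j)
  · have := (le_max_left (T - t) 0).trans hT
    simpa [sub_le_iff_le_add] using this
  · intro i hi s hs
    cases i with
    | zero =>
      have hs' : s < t := by simpa [h0] using hs.2
      simp [hs', ht]
    | succ j =>
      have hs₁ : τ j + t ≤ s := hs.1
      have hs₂ : s < τ (j + 1) + t := hs.2
      have hj := hnonneg j
      have := hconst j (by omega) (s - t) ⟨by linarith, by linarith⟩
      simpa [not_lt.mpr (show t ≤ s by linarith), not_lt.mpr hj] using this

section

variable {M : Type*} [NormedAddCommGroup M] [NormedSpace ℝ M]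
  {f : ℝ → M → M} {Ω : Set ℝ} {c : ℝ}

theorem IsTraj.prepend {u : ℝ → ℝ} {x y : ℝ → M} (hx : IsTraj f u x)
    (hy : IsTraj f (fun _ => c) y) {t : ℝ} (hxy : x 0 = y t) :
    IsTraj f (fun s => if s < t then c else u (s - t))
      (fun s => if s < t then y s else x (s - t)) := by
  have hright : ∀ s, t ≤ s → (if s < t then y s else x (s - t)) = x (s - t) :=
    fun s hs => if_neg (not_lt.mpr hs)
  have hleft : ∀ s, s ≤ t → (if s < t then y s else x (s - t)) = y s := by
    intro s hs
    rcases hs.lt_or_eq with h | rfl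
    · exact if_pos h
    · simp [hxy]
  refine ⟨?_, fun s hs => ?_⟩
  · have hl : ContinuousOn (fun s => if s < t then y s else x (s - t)) (Icc 0 t) :=
      (hy.1.mono Icc_subset_Ici_self).congr fun s hs => hleft s hs.2
    have hr : ContinuousOn (fun s => if s < t then y s else x (s - t)) (Ici t) := by
      refine (hx.1.comp (by fun_prop) fun s hs => ?_).congr fun s hs => hright s hs
      simpa using hs
    refine (hl.union_of_isClosed hr isClosed_Icc isClosed_Ici).mono fun s hs => ?_
    rcases le_total s t with h | h
    · exact Or.inl ⟨hs, h⟩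
    · exact Or.inr h
  · rcases lt_or_ge s t with h | h
    · simp only [if_pos h]
      refine (hy.2 s hs).congr_of_eventuallyEq ?_ (if_pos h)
      filter_upwards [mem_nhdsWithin_of_mem_nhds (Iio_mem_nhds h)] with r hr
      exact if_pos hr
    · simp only [if_neg (not_lt.mpr h)]
      have hd := (hx.2 (s - t) (sub_nonneg.mpr h)).scomp s
        ((hasDerivWithinAt_id s (Ici s)).sub_const t)
        (fun r (hr : s ≤ r) => sub_le_sub_right hr t)
      rw [one_smul] at hd
      exact hd.congr (fun r hr => hright r (h.trans hr)) (hright s h)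

theorem posOrbit_subset_of_const (hc : c ∈ Ω) {y : ℝ → M} (hy : IsTraj f (fun _ => c) y)
    {t : ℝ} (ht : 0 ≤ t) : PosOrbit f Ω (y t) ⊆ PosOrbit f Ω (y 0) := by
  rcases ht.eq_or_lt with rfl | ht
  · exact Subset.rfl
  rintro q ⟨u, x, T, hu, hx, hx0, hT, rfl⟩
  refine ⟨_, _, T + t, ⟨fun s => ?_, hu.2.prepend c ht⟩, hx.prepend hy hx0, if_pos ht,
    by positivity, ?_⟩
  · split_ifs
    exacts [hc, hu.1 _]
  · simp [hT]

end

/-- The solution of `Σ_ℍ` with constant control `c`, for `A` with `A² = 0` and `tr A = 0`. -/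
def heisFlow (A : Matrix (Fin 2) (Fin 2) ℝ) (η ζ : V2) (α c : ℝ) (p : V2 × ℝ) (t : ℝ) :
    V2 × ℝ :=
  (p.1 + t • (A.mulVec p.1 + c • ζ) + (t ^ 2 / 2) • c • A.mulVec ζ,
    p.2 + t * (c * α) + omega2 (t • p.1 + (t ^ 2 / 2) • (A.mulVec p.1 + c • ζ) +
      (t ^ 3 / 6) • c • A.mulVec ζ) (theta η + (c / 2) • ζ))

section

variable {A : Matrix (Fin 2) (Fin 2) ℝ} {η ζ : V2} {α c : ℝ}

theorem mulVec_mulVec_eq_zero (hdet : A.det = 0) (htr : A.trace = 0) (v : V2) :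
    A.mulVec (A.mulVec v) = 0 := by
  have hA : A * A = 0 := by
    have h := A.aeval_self_charpoly
    rw [charpoly_fin_two] at h
    simpa [hdet, htr, sq] using h
  rw [mulVec_mulVec, hA, zero_mulVec]

@[simp]
theorem heisFlow_zero (p : V2 × ℝ) : heisFlow A η ζ α c p 0 = p := by
  simp [heisFlow, omega2]

theorem isTraj_heisFlow (hdet : A.det = 0) (htr : A.trace = 0) (p : V2 × ℝ) :
    IsTraj (heisF A η ζ α) (fun _ => c) (heisFlow A η ζ α c p) := by
  have hderiv (t : ℝ) : HasDerivAt (heisFlow A η ζ α c p)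
      (heisF A η ζ α c (heisFlow A η ζ α c p t)) t := by
    have h1 := hasDerivAt_id t
    have h2 : HasDerivAt (fun t : ℝ => t ^ 2 / 2) t t := by
      simpa using ((hasDerivAt_id t).pow 2).div_const 2
    have h3 : HasDerivAt (fun t : ℝ => t ^ 3 / 6) (t ^ 2 / 2) t := by
      refine (((hasDerivAt_id t).pow 3).div_const 6).congr_deriv ?_
      norm_num
      ring
    refine HasDerivAt.prodMk ?_ ?_
    · refine (((h1.smul_const (A.mulVec p.1 + c • ζ)).const_add p.1).add
        (h2.smul_const (c • A.mulVec ζ))).congr_deriv ?_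
      simp only [heisFlow, mulVec_add, mulVec_smul, mulVec_mulVec_eq_zero hdet htr]
      module
    · have hcomp (i : Fin 2) : HasDerivAt (fun t : ℝ => (t • p.1 +
          (t ^ 2 / 2) • (A.mulVec p.1 + c • ζ) + (t ^ 3 / 6) • c • A.mulVec ζ) i)
          ((heisFlow A η ζ α c p t).1 i) t := by
        have h := hasDerivAt_pi.1 (((h1.smul_const p.1).add
          (h2.smul_const (A.mulVec p.1 + c • ζ))).add (h3.smul_const (c • A.mulVec ζ))) i
        rwa [one_smul] at h
      have h := ((h1.mul_const (c * α)).const_add p.2).add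
        (((hcomp 0).mul_const ((theta η + (c / 2) • ζ) 1)).sub
          ((hcomp 1).mul_const ((theta η + (c / 2) • ζ) 0)))
      refine h.congr_deriv ?_
      simp only [htr, omega2]
      ring
  exact ⟨fun t _ => (hderiv t).continuousAt.continuousWithinAt,
    fun t _ => (hderiv t).hasDerivWithinAt⟩

end

/-- The point of `ℍ` with coordinates `y`, `x` in the basis `ζ`, `Aζ` and height `z`. -/
def heisPoint (A : Matrix (Fin 2) (Fin 2) ℝ) (ζ : V2) (y x z : ℝ) : V2 × ℝ :=
  (y • ζ + x • A.mulVec ζ, z)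

/-- From every point over `(y, x)` one can reach a point over `(y', x')` by a fixed vertical
displacement. -/
def FiberReach (A : Matrix (Fin 2) (Fin 2) ℝ) (η ζ : V2) (α : ℝ) (Ω : Set ℝ)
    (y x y' x' : ℝ) : Prop :=
  ∃ d : ℝ, ∀ z, PosOrbit (heisF A η ζ α) Ω (heisPoint A ζ y' x' (z + d)) ⊆
    PosOrbit (heisF A η ζ α) Ω (heisPoint A ζ y x z)

section

variable {A : Matrix (Fin 2) (Fin 2) ℝ} {η ζ : V2} {α : ℝ} {Ω : Set ℝ}

theorem FiberReach.trans {y x y' x' y'' x'' : ℝ} (h : FiberReach A η ζ α Ω y x y' x')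
    (h' : FiberReach A η ζ α Ω y' x' y'' x'') : FiberReach A η ζ α Ω y x y'' x'' := by
  obtain ⟨d, hd⟩ := h
  obtain ⟨d', hd'⟩ := h'
  exact ⟨d + d', fun z => by simpa [add_assoc] using (hd' (z + d)).trans (hd z)⟩

theorem posOrbit_heisFlow_subset (hdet : A.det = 0) (htr : A.trace = 0) {c t : ℝ} (hc : c ∈ Ω)
    (ht : 0 ≤ t) (p : V2 × ℝ) : PosOrbit (heisF A η ζ α) Ω (heisFlow A η ζ α c p t) ⊆
      PosOrbit (heisF A η ζ α) Ω p := by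
  simpa using posOrbit_subset_of_const hc (isTraj_heisFlow (η := η) (ζ := ζ) (α := α) hdet htr p) ht

theorem fiberReach_const (hdet : A.det = 0) (htr : A.trace = 0) {c t : ℝ} (hc : c ∈ Ω)
    (ht : 0 ≤ t) (y x : ℝ) :
    FiberReach A η ζ α Ω y x (y + c * t) (x + y * t + c * t ^ 2 / 2) := by
  refine ⟨(heisFlow A η ζ α c (heisPoint A ζ y x 0) t).2, fun z => ?_⟩
  convert posOrbit_heisFlow_subset hdet htr hc ht (heisPoint A ζ y x z) using 2
  refine Prod.ext ?_ ?_
  · simp only [heisPoint, heisFlow, mulVec_add, mulVec_smul, mulVec_mulVec_eq_zero hdet htr]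
    module
  · simp only [heisPoint, heisFlow]
    ring

variable {δ : ℝ}

theorem exists_mul_eq_of_mem (hδ : 0 < δ) (hpos : δ ∈ Ω) (hneg : -δ ∈ Ω) (a : ℝ) :
    ∃ c ∈ Ω, -c ∈ Ω ∧ ∃ t, 0 ≤ t ∧ c * t = a := by
  rcases le_total 0 a with ha | ha
  · exact ⟨δ, hpos, hneg, a / δ, by positivity, by field_simp⟩
  · exact ⟨-δ, hneg, by simpa using hpos, -a / δ, div_nonneg (by linarith) hδ.le, by field_simp⟩

theorem fiberReach_all (hdet : A.det = 0) (htr : A.trace = 0) (hδ : 0 < δ) (hpos : δ ∈ Ω)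
    (hneg : -δ ∈ Ω) (y x y' x' : ℝ) : FiberReach A η ζ α Ω y x y' x' := by
  obtain ⟨c₁, hc₁, -, t₁, ht₁, h₁⟩ := exists_mul_eq_of_mem hδ hpos hneg (-y)
  obtain ⟨c₃, hc₃, -, t₃, ht₃, h₃⟩ := exists_mul_eq_of_mem hδ hpos hneg y'
  set a := x + y * t₁ + c₁ * t₁ ^ 2 / 2 with ha
  set b := x' - c₃ * t₃ ^ 2 / 2 with hb
  obtain ⟨c₂, hc₂, hc₂', s, hs, h₂⟩ := exists_mul_eq_of_mem hδ hpos hneg (b - a)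
  have start : FiberReach A η ζ α Ω y x 0 a := by
    simpa [h₁] using fiberReach_const hdet htr hc₁ ht₁ y x
  have finish : FiberReach A η ζ α Ω 0 b y' x' := by
    simpa [h₃, hb] using fiberReach_const hdet htr hc₃ ht₃ 0 b
  have middle : FiberReach A η ζ α Ω 0 a 0 b := by
    have h := (fiberReach_const (η := η) (ζ := ζ) (α := α) hdet htr hc₂ (Real.sqrt_nonneg s) 0 a).trans
      (fiberReach_const hdet htr hc₂' (Real.sqrt_nonneg s) _ _)
    convert h using 1
    · ring
    · linear_combination -h₂ + c₂ * (-Real.sq_sqrt hs)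
  exact start.trans (middle.trans finish)

theorem posOrbit_heisPoint_hover (hdet : A.det = 0) (htr : A.trace = 0) (h0 : (0 : ℝ) ∈ Ω)
    {t : ℝ} (ht : 0 ≤ t) (x z : ℝ) :
    PosOrbit (heisF A η ζ α) Ω
        (heisPoint A ζ 0 x (z + t * (x * omega2 (A.mulVec ζ) (theta η)))) ⊆
      PosOrbit (heisF A η ζ α) Ω (heisPoint A ζ 0 x z) := by
  convert posOrbit_heisFlow_subset hdet htr h0 ht (heisPoint A ζ 0 x z) using 2
  refine Prod.ext ?_ ?_
  · simp only [heisPoint, heisFlow, mulVec_add, mulVec_smul, mulVec_mulVec_eq_zero hdet htr]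
    module
  · simp only [heisPoint, heisFlow, mulVec_add, mulVec_smul, mulVec_mulVec_eq_zero hdet htr, omega2,
      Pi.add_apply, Pi.smul_apply, Pi.zero_apply, smul_eq_mul]
    ring

theorem exists_heisPoint (hLARC : omega2 (A.mulVec ζ) ζ ≠ 0) (p : V2 × ℝ) :
    ∃ y x, p = heisPoint A ζ y x p.2 := by
  refine ⟨omega2 (A.mulVec ζ) p.1 / omega2 (A.mulVec ζ) ζ,
    omega2 p.1 ζ / omega2 (A.mulVec ζ) ζ, Prod.ext ?_ rfl⟩
  funext i
  simp only [heisPoint, Pi.add_apply, Pi.smul_apply, smul_eq_mul]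
  field_simp
  fin_cases i <;> simp only [omega2, Fin.zero_eta, Fin.mk_one] <;> ring

theorem mem_posOrbit_self (hdet : A.det = 0) (htr : A.trace = 0) (h0 : (0 : ℝ) ∈ Ω)
    (p : V2 × ℝ) : p ∈ PosOrbit (heisF A η ζ α) Ω p :=
  ⟨fun _ => 0, heisFlow A η ζ α 0 p, 0, ⟨fun _ => h0, piecewiseConst_const 0⟩,
    isTraj_heisFlow hdet htr p, heisFlow_zero p, le_rfl, heisFlow_zero p⟩

theorem posOrbit_heisF_eq_univ (hdet : A.det = 0) (htr : A.trace = 0)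
    (hLARC : omega2 (A.mulVec ζ) ζ ≠ 0) (hadrank : omega2 (A.mulVec ζ) (theta η) ≠ 0)
    (hδ : 0 < δ) (hpos : δ ∈ Ω) (hneg : -δ ∈ Ω) (h0 : (0 : ℝ) ∈ Ω) (p : V2 × ℝ) :
    PosOrbit (heisF A η ζ α) Ω p = univ := by
  refine eq_univ_of_forall fun q => ?_
  obtain ⟨y, x, hp⟩ := exists_heisPoint hLARC p
  obtain ⟨y', x', hq⟩ := exists_heisPoint hLARC q
  set b := omega2 (A.mulVec ζ) (theta η) with hb
  obtain ⟨d₁, h₁⟩ := fiberReach_all (η := η) (ζ := ζ) (α := α) hdet htr hδ hpos hneg y x 0 b⁻¹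
  obtain ⟨d₂, h₂⟩ := fiberReach_all (η := η) (ζ := ζ) (α := α) hdet htr hδ hpos hneg 0 b⁻¹ 0 (-b⁻¹)
  obtain ⟨d₃, h₃⟩ := fiberReach_all (η := η) (ζ := ζ) (α := α) hdet htr hδ hpos hneg 0 (-b⁻¹) y' x'
  obtain ⟨s, t, hs, ht, hst⟩ : ∃ s t : ℝ, 0 ≤ s ∧ 0 ≤ t ∧ s - t = q.2 - p.2 - d₁ - d₂ - d₃ :=
    ⟨_, _, posPart_nonneg _, negPart_nonneg _, posPart_sub_negPart _⟩
  have hup := posOrbit_heisPoint_hover (η := η) (ζ := ζ) (α := α) hdet htr h0 hs b⁻¹ (p.2 + d₁)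
  have hdown := posOrbit_heisPoint_hover (η := η) (ζ := ζ) (α := α) hdet htr h0 ht (-b⁻¹)
    (p.2 + d₁ + s * (b⁻¹ * b) + d₂)
  rw [hp]
  refine h₁ _ (hup (h₂ _ (hdown (h₃ _ ?_))))
  convert mem_posOrbit_self hdet htr h0 q using 2
  rw [hq]
  congr 1
  rw [← hb, neg_mul, inv_mul_cancel₀ hadrank]
  linear_combination hst

end

/-- if `det A = 0`, `tr A = 0`, the LARC `ω(Aζ,ζ) ≠ 0` holds and the
ad-rank condition `ω(Aζ,θη) ≠ 0` holds, then `ℍ = ℝ² × ℝ` is the only control set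
of `Σ_ℍ`. -/
theorem stmt0 (A : Matrix (Fin 2) (Fin 2) ℝ) (η ζ : V2) (α u₁ u₂ : ℝ)
    (h₁ : u₁ < 0) (h₂ : 0 < u₂)
    (hdet : A.det = 0) (htr : A.trace = 0)
    (hLARC : omega2 (A.mulVec ζ) ζ ≠ 0)
    (hadrank : omega2 (A.mulVec ζ) (theta η) ≠ 0) :
    IsControlSet (heisF A η ζ α) (Icc u₁ u₂) (univ : Set (V2 × ℝ)) ∧
    ∀ C : Set (V2 × ℝ), IsControlSet (heisF A η ζ α) (Icc u₁ u₂) C →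
      C = (univ : Set (V2 × ℝ)) := by
  set δ := min (-u₁) u₂
  have hδ : 0 < δ := lt_min (neg_pos.mpr h₁) h₂
  have hδ₁ : δ ≤ -u₁ := min_le_left _ _
  have hδ₂ : δ ≤ u₂ := min_le_right _ _
  have h0 : (0 : ℝ) ∈ Icc u₁ u₂ := ⟨h₁.le, h₂.le⟩
  have huniv : ControlSetProp (heisF A η ζ α) (Icc u₁ u₂) univ := by
    refine ⟨univ_nonempty, fun p _ => ?_, fun p _ => ?_⟩
    · exact ⟨fun _ => 0, heisFlow A η ζ α 0 p, ⟨fun _ => h0, piecewiseConst_const 0⟩,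
        isTraj_heisFlow hdet htr p, heisFlow_zero p, fun _ _ => mem_univ _⟩
    · rw [posOrbit_heisF_eq_univ hdet htr hLARC hadrank hδ
        (mem_Icc.mpr ⟨by linarith, hδ₂⟩) (mem_Icc.mpr ⟨by linarith, by linarith⟩) h0 p]
      exact subset_closure
  exact ⟨⟨huniv, fun C' _ h => (univ_subset_iff.mp h).symm⟩,
    fun C hC => hC.2 univ huniv (subset_univ C)⟩
end
end

section
/- Assume det A < 0, tr A = 0 (so A has a pair of nonzero real eigenvalues ±√(−det A)), ω(Aζ, ζ) ≠ 0, and α·det A + ω(Aζ, θη) = 0 (so the ad-rank condition fails). Then for every z ∈ ℝ the singleton {(0,z)} is a control set of Σ_ℍ, and conversely every control set of Σ_ℍ is a singleton {(0,z)} for some z ∈ ℝ; that is, the line ker 𝒟 = {0} × ℝ (where 𝒟(v,z) = (Av, ω(v,θη) + (tr A)z)) is a continuum of one-point control sets of Σ_ℍ. -/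
open Set Matrix

noncomputable section

/-- A Lyapunov function of `Σ_ℍ`: nonincreasing along every trajectory when `tr A = 0`,
`det A < 0` and the ad-rank condition fails. -/
def lyapunov (A : Matrix (Fin 2) (Fin 2) ℝ) (η ζ : V2) (p : V2 × ℝ) : ℝ :=
  2 * omega2 (A.mulVec ζ) ζ * (p.2 + omega2 (A.mulVec p.1) (theta η) / A.det) +
    omega2 p.1 ζ * omega2 p.1 (A.mulVec ζ)

/-- The rate at which `lyapunov` decreases along trajectories. -/
def decayRate (A : Matrix (Fin 2) (Fin 2) ℝ) (ζ v : V2) : ℝ :=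
  omega2 v (A.mulVec ζ) ^ 2 - A.det * omega2 v ζ ^ 2

theorem continuous_lyapunov (A : Matrix (Fin 2) (Fin 2) ℝ) (η ζ : V2) :
    Continuous (lyapunov A η ζ) := by
  unfold lyapunov omega2 theta
  simp only [Matrix.mulVec, dotProduct, Fin.sum_univ_two]
  fun_prop

theorem decayRate_nonneg {A : Matrix (Fin 2) (Fin 2) ℝ} (hdet : A.det < 0) (ζ v : V2) :
    0 ≤ decayRate A ζ v := by
  unfold decayRate
  nlinarith [sq_nonneg (omega2 v (A.mulVec ζ)), sq_nonneg (omega2 v ζ)]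

theorem eq_zero_of_decayRate_eq_zero {A : Matrix (Fin 2) (Fin 2) ℝ} {ζ v : V2}
    (hdet : A.det < 0) (hLARC : omega2 (A.mulVec ζ) ζ ≠ 0) (h : decayRate A ζ v = 0) :
    v = 0 := by
  unfold decayRate at h
  have hζ : omega2 v ζ = 0 := by
    have : omega2 v ζ ^ 2 = 0 := by
      nlinarith [sq_nonneg (omega2 v (A.mulVec ζ)), sq_nonneg (omega2 v ζ)]
    exact pow_eq_zero_iff two_ne_zero |>.mp this
  have hAζ : omega2 v (A.mulVec ζ) = 0 := by
    rw [hζ] at h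
    exact pow_eq_zero_iff two_ne_zero |>.mp (by linarith)
  generalize A.mulVec ζ = w at *
  unfold omega2 at *
  ext i
  apply mul_left_cancel₀ hLARC
  fin_cases i
  · simp only [Fin.zero_eta, Pi.zero_apply]
    linear_combination w 0 * hζ - ζ 0 * hAζ
  · simp only [Fin.mk_one, Pi.zero_apply]
    linear_combination w 1 * hζ - ζ 1 * hAζ

/-- Along a trajectory, `lyapunov` has right derivative `-decayRate`. -/
theorem IsTraj.hasDerivWithinAt_lyapunov {A : Matrix (Fin 2) (Fin 2) ℝ} {η ζ : V2} {α : ℝ}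
    (hdet : A.det < 0) (htr : A.trace = 0)
    (hadrank : α * A.det + omega2 (A.mulVec ζ) (theta η) = 0)
    {u : ℝ → ℝ} {x : ℝ → V2 × ℝ} (hx : IsTraj (heisF A η ζ α) u x) {t : ℝ} (ht : 0 ≤ t) :
    HasDerivWithinAt (fun s => lyapunov A η ζ (x s)) (-decayRate A ζ (x t).1) (Ici t) t := by
  have h := hx.2 t ht
  have hv := hasDerivWithinAt_pi.mp
    ((ContinuousLinearMap.fst ℝ V2 ℝ).hasFDerivAt.comp_hasDerivWithinAt t h)
  have h0 : HasDerivWithinAt (fun s => (x s).1 0) _ (Ici t) t := hv 0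
  have h1 : HasDerivWithinAt (fun s => (x s).1 1) _ (Ici t) t := hv 1
  have hz : HasDerivWithinAt (fun s => (x s).2) _ (Ici t) t :=
    (ContinuousLinearMap.snd ℝ V2 ℝ).hasFDerivAt.comp_hasDerivWithinAt t h
  have hd := hdet.ne
  have htr' : A 1 1 = -A 0 0 := by
    rw [Matrix.trace_fin_two] at htr
    linarith
  have hdet' : A.det = -(A 0 0 ^ 2 + A 0 1 * A 1 0) := by
    rw [Matrix.det_fin_two, htr']
    ring
  have hA0 := (h0.const_mul (A 0 0)).add (h1.const_mul (A 0 1))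
  have hA1 := (h0.const_mul (A 1 0)).add (h1.const_mul (A 1 1))
  have key := ((hz.add (((hA0.mul_const (theta η 1)).sub
      (hA1.mul_const (theta η 0))).div_const A.det)).const_mul
        (2 * omega2 (A.mulVec ζ) ζ)).add
    (((h0.mul_const (ζ 1)).sub (h1.mul_const (ζ 0))).mul
      ((h0.mul_const (A.mulVec ζ 1)).sub (h1.mul_const (A.mulVec ζ 0))))
  refine HasDerivWithinAt.congr_deriv (key.congr_of_mem (fun s _ => ?_) (mem_Ici.mpr le_rfl)) ?_
  · simp [lyapunov, omega2, Matrix.mulVec, dotProduct, Fin.sum_univ_two]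
  · simp only [ContinuousLinearMap.coe_fst', ContinuousLinearMap.coe_snd', Pi.sub_apply,
      decayRate, heisF, omega2, Matrix.mulVec, dotProduct, Fin.sum_univ_two, htr, htr',
      Pi.add_apply, Pi.smul_apply, smul_eq_mul] at hadrank ⊢
    field_simp
    rw [hdet'] at hadrank ⊢
    linear_combination 2 * u t * (ζ 1 * (A 0 0 * ζ 0 + A 0 1 * ζ 1) -
      ζ 0 * (ζ 0 * A 1 0 - A 0 0 * ζ 1)) * hadrank

theorem IsTraj.lyapunov_le {A : Matrix (Fin 2) (Fin 2) ℝ} {η ζ : V2} {α : ℝ}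
    (hdet : A.det < 0) (htr : A.trace = 0)
    (hadrank : α * A.det + omega2 (A.mulVec ζ) (theta η) = 0)
    {u : ℝ → ℝ} {x : ℝ → V2 × ℝ} (hx : IsTraj (heisF A η ζ α) u x) {t : ℝ} (ht : 0 ≤ t) :
    lyapunov A η ζ (x t) ≤ lyapunov A η ζ (x 0) := by
  refine image_le_of_deriv_right_le_deriv_boundary (a := 0) (b := t)
    (f := fun s => lyapunov A η ζ (x s)) (f' := fun s => -decayRate A ζ (x s).1)
    (B := fun _ => lyapunov A η ζ (x 0)) (B' := fun _ => 0)
    ((continuous_lyapunov A η ζ).comp_continuousOn (hx.1.mono Icc_subset_Ici_self))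
    (fun s hs => hx.hasDerivWithinAt_lyapunov hdet htr hadrank hs.1) le_rfl
    continuousOn_const (fun s _ => hasDerivWithinAt_const _ _ _)
    (fun s _ => neg_nonpos.mpr (decayRate_nonneg hdet ζ _)) ⟨ht, le_rfl⟩

theorem lyapunov_le_of_mem_closure_posOrbit {A : Matrix (Fin 2) (Fin 2) ℝ} {η ζ : V2} {α : ℝ}
    (hdet : A.det < 0) (htr : A.trace = 0)
    (hadrank : α * A.det + omega2 (A.mulVec ζ) (theta η) = 0) {Ω : Set ℝ} {p q : V2 × ℝ}
    (hq : q ∈ closure (PosOrbit (heisF A η ζ α) Ω p)) :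
    lyapunov A η ζ q ≤ lyapunov A η ζ p := by
  have hsub : PosOrbit (heisF A η ζ α) Ω p ⊆ {r | lyapunov A η ζ r ≤ lyapunov A η ζ p} := by
    rintro _ ⟨u, x, T, -, hx, rfl, hT, rfl⟩
    exact hx.lyapunov_le hdet htr hadrank hT
  exact closure_minimal hsub
    (isClosed_le (continuous_lyapunov A η ζ) continuous_const) hq

/-- Every set with the two defining properties of a control set is a point of `{0} × ℝ`. -/
theorem ControlSetProp.eq_singleton {A : Matrix (Fin 2) (Fin 2) ℝ} {η ζ : V2} {α : ℝ}
    (hdet : A.det < 0) (htr : A.trace = 0) (hLARC : omega2 (A.mulVec ζ) ζ ≠ 0)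
    (hadrank : α * A.det + omega2 (A.mulVec ζ) (theta η) = 0) {Ω : Set ℝ} {C : Set (V2 × ℝ)}
    (hC : ControlSetProp (heisF A η ζ α) Ω C) : ∃ z : ℝ, C = {((0 : V2), z)} := by
  obtain ⟨⟨p, hp⟩, hstay, hreach⟩ := hC
  have hconst : ∀ q ∈ C, ∀ r ∈ C, lyapunov A η ζ q = lyapunov A η ζ r := fun q hq r hr =>
    le_antisymm (lyapunov_le_of_mem_closure_posOrbit hdet htr hadrank (hreach r hr hq))
      (lyapunov_le_of_mem_closure_posOrbit hdet htr hadrank (hreach q hq hr))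
  have hzero : ∀ q ∈ C, q.1 = 0 := by
    intro q hq
    obtain ⟨u, x, -, hx, rfl, hxC⟩ := hstay q hq
    have hcst : HasDerivWithinAt (fun s => lyapunov A η ζ (x s)) 0 (Ici 0) 0 :=
      (hasDerivWithinAt_const _ _ (lyapunov A η ζ (x 0))).congr_of_mem
        (fun s hs => hconst _ (hxC s hs) _ hq) (mem_Ici.mpr le_rfl)
    have h := (uniqueDiffWithinAt_Ici (0 : ℝ)).eq_deriv _ hcst
      (hx.hasDerivWithinAt_lyapunov hdet htr hadrank le_rfl)
    exact eq_zero_of_decayRate_eq_zero hdet hLARC (by linarith)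
  refine ⟨p.2, eq_singleton_iff_unique_mem.mpr ⟨?_, fun q hq => ?_⟩⟩
  · rwa [← hzero p hp]
  · have h := hconst q hq p hp
    simp only [lyapunov, hzero q hq, hzero p hp, add_left_inj] at h
    exact Prod.ext (hzero q hq) (by
      simpa using mul_left_cancel₀ (mul_ne_zero two_ne_zero hLARC) h)

theorem controlSetProp_singleton (A : Matrix (Fin 2) (Fin 2) ℝ) (η ζ : V2) (α : ℝ)
    (htr : A.trace = 0) {Ω : Set ℝ} (hΩ : (0 : ℝ) ∈ Ω) (z : ℝ) :
    ControlSetProp (heisF A η ζ α) Ω {((0 : V2), z)} := by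
  have hadm : Admissible Ω (fun _ => 0) := by
    refine ⟨fun _ => hΩ, fun T _ => ?_⟩
    obtain ⟨n, hn⟩ := exists_nat_ge T
    exact ⟨n, fun k => k, Nat.cast_zero, Nat.strictMono_cast, hn, fun _ _ _ _ => rfl⟩
  have htraj : IsTraj (heisF A η ζ α) (fun _ => 0) (fun _ => ((0 : V2), z)) := by
    refine ⟨continuousOn_const, fun t _ => ?_⟩
    convert hasDerivWithinAt_const t (Ici t) ((0 : V2), z) using 1
    simp [heisF, htr, omega2]
  refine ⟨singleton_nonempty _, ?_, ?_⟩
  · rintro _ rfl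
    exact ⟨_, _, hadm, htraj, rfl, fun _ _ => rfl⟩
  · rintro _ rfl _ rfl
    exact subset_closure ⟨_, _, 0, hadm, htraj, rfl, le_rfl, rfl⟩

/-- if `det A < 0`, `tr A = 0` (a pair of nonzero real eigenvalues),
the LARC `ω(Aζ,ζ) ≠ 0` holds and the ad-rank condition fails
(`α·det A + ω(Aζ,θη) = 0`), then the line `ker 𝒟 = {0} × ℝ` is a continuum of
one-point control sets of `Σ_ℍ`: every `{(0,z)}` is a control set, and every
control set is of this form. -/
theorem stmt4 (A : Matrix (Fin 2) (Fin 2) ℝ) (η ζ : V2) (α u₁ u₂ : ℝ)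
    (h₁ : u₁ < 0) (h₂ : 0 < u₂)
    (hdet : A.det < 0) (htr : A.trace = 0)
    (hLARC : omega2 (A.mulVec ζ) ζ ≠ 0)
    (hadrank : α * A.det + omega2 (A.mulVec ζ) (theta η) = 0) :
    (∀ z : ℝ, IsControlSet (heisF A η ζ α) (Icc u₁ u₂) {(((0 : V2), z) : V2 × ℝ)}) ∧
    (∀ C : Set (V2 × ℝ), IsControlSet (heisF A η ζ α) (Icc u₁ u₂) C →
      ∃ z : ℝ, C = {(((0 : V2), z) : V2 × ℝ)}) := by
  refine ⟨fun z => ⟨controlSetProp_singleton A η ζ α htr (mem_Icc.mpr ⟨h₁.le, h₂.le⟩) z, fun C hC hsub => ?_⟩,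
    fun C hC => hC.1.eq_singleton hdet htr hLARC hadrank⟩
  obtain ⟨w, rfl⟩ := hC.eq_singleton hdet htr hLARC hadrank
  rw [singleton_subset_iff.mp hsub]
end
end

section
/- Let Z = (ζ, α) ∈ 𝔥. Then the vectors Z, 𝒟Z, 𝒟²Z are linearly independent (equivalently, span{𝒟^k Z : 0 ≤ k ≤ 2} = 𝔥, i.e. the ad-rank condition holds) if and only if ω(Aζ, ζ)·(α·det A + ω(Aζ, θη)) ≠ 0. -/
open Set Matrix

noncomputable section

/-- The bracket of the Heisenberg Lie algebra `𝔥 = ℝ² × ℝ`: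
`[(ζ₁,α₁),(ζ₂,α₂)] = (0, ω(ζ₁,ζ₂))`. -/
def hbracket (x y : V2 × ℝ) : V2 × ℝ := ((0 : V2), omega2 x.1 y.1)

/-- The coordinate isomorphism `ℝ² × ℝ ≃ ℝ³`. -/
def coordEquiv : (V2 × ℝ) ≃ₗ[ℝ] (Fin 3 → ℝ) where
  toFun p := ![p.1 0, p.1 1, p.2]
  invFun u := (![u 0, u 1], u 2)
  map_add' p q := by ext i; fin_cases i <;> simp
  map_smul' c p := by ext i; fin_cases i <;> simp
  left_inv p := by
    refine Prod.ext ?_ rfl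
    ext i; fin_cases i <;> rfl
  right_inv u := by ext i; fin_cases i <;> rfl

lemma linearIndependent_iff_det_coordEquiv_ne_zero (v : Fin 3 → V2 × ℝ) :
    LinearIndependent ℝ v ↔ (Matrix.of fun i => coordEquiv (v i)).det ≠ 0 := by
  rw [← isUnit_iff_ne_zero, ← Matrix.isUnit_iff_isUnit_det,
    ← Matrix.linearIndependent_rows_iff_isUnit]
  exact (LinearMap.linearIndependent_iff coordEquiv.toLinearMap coordEquiv.ker).symm

lemma det_coordEquiv_Dmap (A : Matrix (Fin 2) (Fin 2) ℝ) (η ζ : V2) (α : ℝ) :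
    (Matrix.of fun i => coordEquiv
      (![((ζ, α) : V2 × ℝ), Dmap A η (ζ, α), Dmap A η (Dmap A η (ζ, α))] i)).det =
      -(omega2 (A.mulVec ζ) ζ * (α * A.det + omega2 (A.mulVec ζ) (theta η))) := by
  simp [Matrix.det_fin_three, Matrix.det_fin_two, Matrix.trace_fin_two, coordEquiv, Dmap,
    omega2, theta, Matrix.mulVec, dotProduct, Fin.sum_univ_two]
  ring

lemma linearIndependent_iff_span_range_eq_top {v : Fin 3 → V2 × ℝ} :
    LinearIndependent ℝ v ↔ Submodule.span ℝ (Set.range v) = ⊤ := by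
  have hcard : Fintype.card (Fin 3) = Module.finrank ℝ (V2 × ℝ) := by simp
  exact ⟨fun h => h.span_eq_top_of_card_eq_finrank' hcard,
    fun h => linearIndependent_of_top_le_span_of_card_eq_finrank h.ge hcard⟩

/-- for `Z = (ζ,α) ∈ 𝔥`, the vectors `Z, 𝒟Z, 𝒟²Z` are linearly
independent (equivalently, they span `𝔥`, i.e. the ad-rank condition holds) if and
only if `ω(Aζ,ζ)·(α·det A + ω(Aζ,θη)) ≠ 0`. -/
theorem stmt6 (A : Matrix (Fin 2) (Fin 2) ℝ) (η ζ : V2) (α : ℝ) :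
    (LinearIndependent ℝ
        ![((ζ, α) : V2 × ℝ), Dmap A η (ζ, α), Dmap A η (Dmap A η (ζ, α))] ↔
      omega2 (A.mulVec ζ) ζ * (α * A.det + omega2 (A.mulVec ζ) (theta η)) ≠ 0) ∧
    (Submodule.span ℝ
        {((ζ, α) : V2 × ℝ), Dmap A η (ζ, α), Dmap A η (Dmap A η (ζ, α))} = ⊤ ↔
      omega2 (A.mulVec ζ) ζ * (α * A.det + omega2 (A.mulVec ζ) (theta η)) ≠ 0) := by
  have h : LinearIndependent ℝ
        ![((ζ, α) : V2 × ℝ), Dmap A η (ζ, α), Dmap A η (Dmap A η (ζ, α))] ↔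
      omega2 (A.mulVec ζ) ζ * (α * A.det + omega2 (A.mulVec ζ) (theta η)) ≠ 0 := by
    rw [linearIndependent_iff_det_coordEquiv_ne_zero, det_coordEquiv_Dmap, neg_ne_zero]
  refine ⟨h, ?_⟩
  rw [← h, linearIndependent_iff_span_range_eq_top]
  simp only [Matrix.range_cons, Matrix.range_empty, Set.union_empty, Set.singleton_union]
end
end

section
/- Let Z = (ζ, α) ∈ 𝔥. Then the smallest Lie subalgebra of 𝔥 that contains Z and is invariant under 𝒟 equals 𝔥 (i.e. the Lie algebra rank condition holds) if and only if ω(Aζ, ζ) ≠ 0. Equivalently, span{Z, 𝒟Z, [Z, 𝒟Z]} = 𝔥 if and only if ω(Aζ, ζ) ≠ 0. -/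
open Set Matrix

noncomputable section

/-- If `ω(Aζ,ζ) ≠ 0`, then `Z = (ζ,α)`, `𝒟Z` and `[Z,𝒟Z]` span `𝔥`. -/
theorem span_eq_top_of_omega2_ne_zero (A : Matrix (Fin 2) (Fin 2) ℝ) (η ζ : V2) (α : ℝ)
    (h : omega2 (A.mulVec ζ) ζ ≠ 0) :
    Submodule.span ℝ
      {((ζ, α) : V2 × ℝ), Dmap A η (ζ, α), hbracket (ζ, α) (Dmap A η (ζ, α))} = ⊤ := by
  rw [Submodule.eq_top_iff']
  rintro ⟨v, z⟩
  simp only [Submodule.mem_span_insert, Submodule.mem_span_singleton, Dmap, hbracket]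
  generalize A.mulVec ζ = w at h ⊢
  generalize omega2 ζ (theta η) + A.trace * α = β
  have hd : omega2 ζ w ≠ 0 := by
    contrapose! h
    simp only [omega2] at h ⊢
    linarith
  refine ⟨omega2 v w / omega2 ζ w, _, ⟨omega2 ζ v / omega2 ζ w, _,
    ⟨(z - omega2 v w / omega2 ζ w * α - omega2 ζ v / omega2 ζ w * β) / omega2 ζ w, rfl⟩,
    rfl⟩, ?_⟩
  ext i
  · fin_cases i <;> simp <;> field_simp <;> simp only [omega2] <;> ring
  · simp
    field_simp
    ring

/-- If `ω(Aζ,ζ) = 0`, then `Z = (ζ,α)` lies in a proper `𝒟`-invariant subalgebra of `𝔥`. -/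
theorem exists_invariant_ne_top_of_omega2_eq_zero (A : Matrix (Fin 2) (Fin 2) ℝ) (η ζ : V2)
    (α : ℝ) (h : omega2 (A.mulVec ζ) ζ = 0) :
    ∃ S : Submodule ℝ (V2 × ℝ), (∀ x ∈ S, ∀ y ∈ S, hbracket x y ∈ S) ∧
      (∀ x ∈ S, Dmap A η x ∈ S) ∧ ((ζ, α) : V2 × ℝ) ∈ S ∧ S ≠ ⊤ := by
  refine ⟨(ℝ ∙ ζ).comap (LinearMap.fst ℝ V2 ℝ), ?_, ?_, ?_, ?_⟩
  · intro x _ y _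
    simp [hbracket]
  · rintro ⟨v, z⟩ hv
    obtain ⟨c, rfl⟩ := Submodule.mem_span_singleton.1 hv
    change A.mulVec (c • ζ) ∈ ℝ ∙ ζ
    rw [mulVec_smul]
    refine Submodule.smul_mem _ _ ?_
    by_cases h0 : ζ = 0
    · simp [h0]
    generalize A.mulVec ζ = w at h
    simp only [omega2] at h
    rw [Submodule.mem_span_singleton]
    by_cases h1 : ζ 0 = 0
    · have h2 : ζ 1 ≠ 0 := fun h2 => h0 (by ext i; fin_cases i <;> simp [h1, h2])
      refine ⟨w 1 / ζ 1, ?_⟩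
      ext i
      fin_cases i <;> simp <;> field_simp <;> linarith
    · refine ⟨w 0 / ζ 0, ?_⟩
      ext i
      fin_cases i <;> simp <;> field_simp <;> linarith
  · exact Submodule.mem_span_singleton_self ζ
  · intro htop
    have hspan : (ℝ ∙ ζ) = ⊤ := by
      rw [Submodule.eq_top_iff'] at htop ⊢
      exact fun v => htop (v, 0)
    have hle := finrank_span_le_card (R := ℝ) ({ζ} : Set V2)
    rw [hspan, finrank_top] at hle
    simp at hle

/-- for `Z = (ζ,α) ∈ 𝔥`, the smallest Lie subalgebra of `𝔥`
containing `Z` and invariant under `𝒟` equals `𝔥` (the LARC) if and only if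
`ω(Aζ,ζ) ≠ 0`; equivalently, `span{Z, 𝒟Z, [Z,𝒟Z]} = 𝔥` iff `ω(Aζ,ζ) ≠ 0`.
(The smallest such subalgebra is `𝔥` iff every bracket-closed, `𝒟`-invariant
subspace containing `Z` is all of `𝔥`.) -/
theorem stmt7 (A : Matrix (Fin 2) (Fin 2) ℝ) (η ζ : V2) (α : ℝ) :
    ((∀ S : Submodule ℝ (V2 × ℝ),
        (∀ x ∈ S, ∀ y ∈ S, hbracket x y ∈ S) →
        (∀ x ∈ S, Dmap A η x ∈ S) →
        ((ζ, α) : V2 × ℝ) ∈ S → S = ⊤) ↔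
      omega2 (A.mulVec ζ) ζ ≠ 0) ∧
    (Submodule.span ℝ
        {((ζ, α) : V2 × ℝ), Dmap A η (ζ, α), hbracket (ζ, α) (Dmap A η (ζ, α))} = ⊤ ↔
      omega2 (A.mulVec ζ) ζ ≠ 0) := by
  have span_le (S : Submodule ℝ (V2 × ℝ)) (hb : ∀ x ∈ S, ∀ y ∈ S, hbracket x y ∈ S)
      (hD : ∀ x ∈ S, Dmap A η x ∈ S) (hZ : ((ζ, α) : V2 × ℝ) ∈ S) :
      Submodule.span ℝ
        {((ζ, α) : V2 × ℝ), Dmap A η (ζ, α), hbracket (ζ, α) (Dmap A η (ζ, α))} ≤ S := by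
    rw [Submodule.span_le]
    rintro x (rfl | rfl | rfl)
    exacts [hZ, hD _ hZ, hb _ hZ _ (hD _ hZ)]
  refine ⟨⟨fun hS h => ?_, fun h S hb hD hZ => ?_⟩, ⟨fun hspan h => ?_, ?_⟩⟩
  · obtain ⟨S, hb, hD, hZ, hne⟩ := exists_invariant_ne_top_of_omega2_eq_zero A η ζ α h
    exact hne (hS S hb hD hZ)
  · exact top_le_iff.1 (span_eq_top_of_omega2_ne_zero A η ζ α h ▸ span_le S hb hD hZ)
  · obtain ⟨S, hb, hD, hZ, hne⟩ := exists_invariant_ne_top_of_omega2_eq_zero A η ζ α h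
    exact hne (top_le_iff.1 (hspan ▸ span_le S hb hD hZ))
  · exact span_eq_top_of_omega2_ne_zero A η ζ α
end
end

section
/- Assume ω(Aζ, ζ) ≠ 0 (the Lie algebra rank condition) and that the fiber {0} × ℝ is controllable for Σ_ℍ, i.e. for all z₁, z₂ ∈ ℝ there exist T ≥ 0 and an admissible control u with φ(T,(0,z₁),u) = (0,z₂). Let C₂ ⊆ ℝ² be a control set of the planar linear control system v̇ = Av + uζ, u(t) ∈ Ω, such that 0 ∈ interior(C₂). Then C₂ × ℝ is a control set of Σ_ℍ, and it is the unique control set of Σ_ℍ with nonempty interior. -/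
open Set Matrix

noncomputable section

open Filter Topology

/-- `u` is locally constant to the right of every `t ≥ 0` and to the left of every `t > 0`. -/
def LocallyPiecewiseConst (u : ℝ → ℝ) : Prop :=
  (∀ t, 0 ≤ t → ∀ᶠ s in 𝓝[≥] t, u s = u t) ∧
    ∀ t, 0 < t → ∃ c, ∀ᶠ s in 𝓝[<] t, u s = c

theorem PiecewiseConst.locally {u : ℝ → ℝ} (hu : PiecewiseConst u) :
    LocallyPiecewiseConst u := by
  classical
  constructor
  · intro t ht
    obtain ⟨n, τ, hτ0, hτ, hn, hc⟩ := hu (t + 1) (by linarith)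
    have hex : ∃ k, t < τ k := ⟨n, by linarith⟩
    obtain ⟨k, hk⟩ : ∃ k, Nat.find hex = k + 1 := by
      refine Nat.exists_eq_succ_of_ne_zero fun h => ?_
      have := Nat.find_spec hex
      rw [h, hτ0] at this
      linarith
    have h1 : t < τ (k + 1) := hk ▸ Nat.find_spec hex
    have h2 : τ k ≤ t := not_lt.1 (Nat.find_min hex (by omega))
    have h3 : k < n := by
      have := Nat.find_min' hex (m := n) (by linarith)
      omega
    filter_upwards [Ico_mem_nhdsGE h1] with s hs
    rw [hc k h3 s ⟨h2.trans hs.1, hs.2⟩, hc k h3 t ⟨h2, h1⟩]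
  · intro t ht
    obtain ⟨n, τ, hτ0, hτ, hn, hc⟩ := hu t ht.le
    have hex : ∃ k, t ≤ τ k := ⟨n, hn⟩
    obtain ⟨k, hk⟩ : ∃ k, Nat.find hex = k + 1 := by
      refine Nat.exists_eq_succ_of_ne_zero fun h => ?_
      have := Nat.find_spec hex
      rw [h, hτ0] at this
      linarith
    have h1 : t ≤ τ (k + 1) := hk ▸ Nat.find_spec hex
    have h2 : τ k < t := not_le.1 (Nat.find_min hex (by omega))
    have h3 : k < n := by
      have := Nat.find_min' hex (m := n) hn
      omega
    refine ⟨u (τ k), ?_⟩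
    filter_upwards [Ioo_mem_nhdsLT h2] with s hs
    exact hc k h3 s ⟨hs.1.le, hs.2.trans_le h1⟩

/-- A partition on whose pieces `u` is constant can be extended by one more piece. -/
theorem exists_partition_extend {u : ℝ → ℝ} {n : ℕ} {τ : ℕ → ℝ} {a : ℝ} (hτ0 : τ 0 = 0)
    (hτ : StrictMono τ) (hc : ∀ i < n, ∀ s ∈ Ico (τ i) (τ (i + 1)), u s = u (τ i))
    (ha : τ n < a) (hu : ∀ s ∈ Ico (τ n) a, u s = u (τ n)) :
    ∃ (m : ℕ) (σ : ℕ → ℝ), σ 0 = 0 ∧ StrictMono σ ∧ a ≤ σ m ∧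
      ∀ i < m, ∀ s ∈ Ico (σ i) (σ (i + 1)), u s = u (σ i) := by
  refine ⟨n + 1, fun i => if i ≤ n then τ i else a + (i - (n + 1 : ℕ) : ℝ), by simp [hτ0],
    strictMono_nat_of_lt_succ fun i => ?_, by simp, fun i hi s hs => ?_⟩
  · rcases lt_trichotomy i n with h | rfl | h
    · simp only [h.le, Nat.succ_le_of_lt h, if_true]
      exact hτ (Nat.lt_succ_self i)
    · simpa using ha
    · have h1 : ¬ i ≤ n := by omega
      have h2 : ¬ i + 1 ≤ n := by omega
      simp only [h1, h2, if_false]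
      push_cast
      linarith
  · rcases Nat.lt_succ_iff_lt_or_eq.1 hi with h | rfl
    · simp only [h.le, Nat.succ_le_of_lt h, if_true] at hs ⊢
      exact hc i h s hs
    · simp only [le_refl, if_true, Nat.not_succ_le_self, if_false, sub_self, add_zero] at hs ⊢
      exact hu s hs

theorem LocallyPiecewiseConst.piecewiseConst {u : ℝ → ℝ} (hu : LocallyPiecewiseConst u) :
    PiecewiseConst u := by
  by_contra hcon
  unfold PiecewiseConst at hcon
  push Not at hcon
  set P : ℝ → Prop := fun T => ∃ (n : ℕ) (τ : ℕ → ℝ), τ 0 = 0 ∧ StrictMono τ ∧ T ≤ τ n ∧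
    ∀ i < n, ∀ s ∈ Ico (τ i) (τ (i + 1)), u s = u (τ i) with hP
  set S : Set ℝ := {T | 0 ≤ T ∧ ¬ P T} with hS
  have hne : S.Nonempty := by
    obtain ⟨T, hT, h⟩ := hcon
    refine ⟨T, hT, ?_⟩
    rintro ⟨n, τ, h0, hτ, hn, hc⟩
    obtain ⟨i, hi, s, hs, hs'⟩ := h n τ h0 hτ hn
    exact hs' (hc i hi s hs)
  have hbdd : BddBelow S := ⟨0, fun T hT => hT.1⟩
  set t := sInf S
  have ht0 : 0 ≤ t := le_csInf hne fun T hT => hT.1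
  have hlt : ∀ r, 0 ≤ r → r < t → P r := fun r h0 hr => by
    by_contra h
    exact absurd (csInf_le hbdd (show r ∈ S from ⟨h0, h⟩)) (not_le.2 hr)
  have hPt : P t := by
    rcases ht0.eq_or_lt with h | h
    · exact ⟨0, fun i => i, by simp, Nat.strictMono_cast, by simp [← h], by simp⟩
    · obtain ⟨c, hc⟩ := hu.2 t h
      obtain ⟨l, hl, hlc⟩ := (mem_nhdsLT_iff_exists_Ioo_subset' h).1 hc
      have hl' : max l 0 < t := max_lt hl h
      obtain ⟨n, τ, h0, hτ, hn, hτc⟩ := hlt ((max l 0 + t) / 2)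
        (by have := le_max_right l 0; linarith) (by linarith)
      rcases le_or_gt t (τ n) with h1 | h1
      · exact ⟨n, τ, h0, hτ, h1, hτc⟩
      · have hln : l < τ n := by
          have := le_max_left l 0
          linarith
        refine exists_partition_extend h0 hτ hτc h1 fun s hs => ?_
        rw [show u s = c from hlc ⟨hln.trans_le hs.1, hs.2⟩,
          show u (τ n) = c from hlc ⟨hln, h1⟩]
  obtain ⟨b, hb, hPb⟩ : ∃ b, t < b ∧ P b := by
    obtain ⟨n, τ, h0, hτ, hn, hτc⟩ := hPt
    rcases hn.lt_or_eq with h1 | h1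
    · exact ⟨τ n, h1, n, τ, h0, hτ, le_rfl, hτc⟩
    · obtain ⟨b, hb, hbc⟩ := (mem_nhdsGE_iff_exists_Ico_subset).1 (hu.1 t ht0)
      refine ⟨b, hb, exists_partition_extend h0 hτ hτc (h1 ▸ hb) fun s hs => ?_⟩
      rw [← h1] at hs ⊢
      exact hbc hs
  obtain ⟨T, hT, hTb⟩ := exists_lt_of_csInf_lt hne hb
  obtain ⟨n, τ, h0, hτ, hn, hc⟩ := hPb
  exact hT.2 ⟨n, τ, h0, hτ, hTb.le.trans hn, hc⟩

theorem LocallyPiecewiseConst.const (c : ℝ) : LocallyPiecewiseConst fun _ => c :=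
  ⟨fun _ _ => by simp, fun _ _ => ⟨c, by simp⟩⟩

theorem LocallyPiecewiseConst.lincomb {u w : ℝ → ℝ} (hu : LocallyPiecewiseConst u)
    (hw : LocallyPiecewiseConst w) (c d : ℝ) :
    LocallyPiecewiseConst fun t => c * u t + d * w t := by
  refine ⟨fun t ht => ?_, fun t ht => ?_⟩
  · filter_upwards [hu.1 t ht, hw.1 t ht] with s h1 h2
    rw [h1, h2]
  · obtain ⟨a, ha⟩ := hu.2 t ht
    obtain ⟨b, hb⟩ := hw.2 t ht
    refine ⟨c * a + d * b, ?_⟩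
    filter_upwards [ha, hb] with s h1 h2
    rw [h1, h2]

/-- Follow `x` until time `T`, then `y`. -/
def concatAt {X : Type*} (T : ℝ) (x y : ℝ → X) (t : ℝ) : X :=
  if t < T then x t else y (t - T)

theorem concatAt_of_lt {X : Type*} {T t : ℝ} (x y : ℝ → X) (h : t < T) :
    concatAt T x y t = x t := if_pos h

theorem concatAt_of_le {X : Type*} {T t : ℝ} (x y : ℝ → X) (h : T ≤ t) :
    concatAt T x y t = y (t - T) := if_neg (not_lt.2 h)

theorem LocallyPiecewiseConst.concatAt {u w : ℝ → ℝ} {T : ℝ}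
    (hu : LocallyPiecewiseConst u) (hw : LocallyPiecewiseConst w) :
    LocallyPiecewiseConst (concatAt T u w) := by
  refine ⟨fun t ht => ?_, fun t ht => ?_⟩
  · rcases lt_or_ge t T with h | h
    · filter_upwards [hu.1 t ht, Ico_mem_nhdsGE h] with s hs hs'
      rw [concatAt_of_lt _ _ hs'.2, concatAt_of_lt _ _ h, hs]
    · have hm : Tendsto (fun s => s - T) (𝓝[≥] t) (𝓝[≥] (t - T)) :=
        ((continuous_sub_right T).continuousWithinAt).tendsto_nhdsWithin
          fun s hs => sub_le_sub_right (mem_Ici.1 hs) T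
      filter_upwards [hm.eventually (hw.1 (t - T) (by linarith)), self_mem_nhdsWithin] with s hs hs'
      rw [concatAt_of_le _ _ (h.trans hs'), concatAt_of_le _ _ h, hs]
  · rcases le_or_gt t T with h | h
    · obtain ⟨c, hc⟩ := hu.2 t ht
      refine ⟨c, ?_⟩
      filter_upwards [hc, self_mem_nhdsWithin] with s hs hs'
      rw [concatAt_of_lt _ _ (lt_of_lt_of_le hs' h), hs]
    · obtain ⟨c, hc⟩ := hw.2 (t - T) (by linarith)
      have hm : Tendsto (fun s => s - T) (𝓝[<] t) (𝓝[<] (t - T)) :=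
        ((continuous_sub_right T).continuousWithinAt).tendsto_nhdsWithin
          fun s hs => sub_lt_sub_right (mem_Iio.1 hs) T
      refine ⟨c, ?_⟩
      filter_upwards [hm.eventually hc, Ioo_mem_nhdsLT h] with s hs hs'
      rw [concatAt_of_le _ _ hs'.1.le, hs]

section Steering

variable {M : Type*} [NormedAddCommGroup M] [NormedSpace ℝ M]

theorem IsTraj.concatAt {f : ℝ → M → M} {u w : ℝ → ℝ} {x y : ℝ → M} {T : ℝ} (hT : 0 ≤ T)
    (hx : IsTraj f u x) (hy : IsTraj f w y) (hxy : x T = y 0) :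
    IsTraj f (concatAt T u w) (concatAt T x y) := by
  constructor
  · have h1 : ContinuousOn (_root_.concatAt T x y) (Icc 0 T) :=
      (hx.1.mono Icc_subset_Ici_self).congr fun s hs => by
        rcases hs.2.lt_or_eq with h | rfl
        · exact concatAt_of_lt _ _ h
        · rw [concatAt_of_le _ _ le_rfl, sub_self, hxy]
    have h2 : ContinuousOn (_root_.concatAt T x y) (Ici T) := by
      have : ContinuousOn (fun s => y (s - T)) (Ici T) :=
        hy.1.comp (by fun_prop) fun s hs => sub_nonneg.2 (mem_Ici.1 hs)
      exact this.congr fun s hs => concatAt_of_le _ _ hs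
    rw [← Icc_union_Ici_eq_Ici hT]
    exact h1.union_of_isClosed h2 isClosed_Icc isClosed_Ici
  · intro t ht
    rcases lt_or_ge t T with h | h
    · rw [concatAt_of_lt _ _ h, concatAt_of_lt _ _ h]
      refine (hx.2 t ht).congr_of_eventuallyEq_of_mem ?_ self_mem_Ici
      filter_upwards [Ico_mem_nhdsGE h] with s hs
      exact concatAt_of_lt _ _ hs.2
    · rw [concatAt_of_le _ _ h, concatAt_of_le _ _ h]
      have h1 := HasDerivWithinAt.scomp (h := fun s => s - T) (s := Ici t) (t' := Ici (t - T)) t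
        (hy.2 (t - T) (sub_nonneg.2 h)) ((hasDerivAt_id t).sub_const T).hasDerivWithinAt
        fun s hs => sub_le_sub_right (mem_Ici.1 hs) T
      rw [one_smul] at h1
      exact h1.congr (fun s hs => concatAt_of_le _ _ (h.trans hs)) (concatAt_of_le _ _ h)

/-- `p` can be steered to `q` in time `T` by a control with values in `S`. -/
def Steers (f : ℝ → M → M) (S : Set ℝ) (T : ℝ) (p q : M) : Prop :=
  ∃ (u : ℝ → ℝ) (x : ℝ → M), (∀ t, u t ∈ S) ∧ LocallyPiecewiseConst u ∧ IsTraj f u x ∧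
    x 0 = p ∧ x T = q

theorem mem_posOrbit_iff {f : ℝ → M → M} {S : Set ℝ} {p q : M} :
    q ∈ PosOrbit f S p ↔ ∃ T, 0 ≤ T ∧ Steers f S T p q :=
  ⟨fun ⟨u, x, T, hu, hx, h0, hT, hq⟩ => ⟨T, hT, u, x, hu.1, hu.2.locally, hx, h0, hq⟩,
    fun ⟨T, hT, u, x, hu, hu', hx, h0, hq⟩ =>
      ⟨u, x, T, ⟨hu, hu'.piecewiseConst⟩, hx, h0, hT, hq⟩⟩

theorem Steers.mono {f : ℝ → M → M} {S S' : Set ℝ} {T : ℝ} {p q : M} (h : Steers f S T p q)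
    (hS : S ⊆ S') : Steers f S' T p q :=
  let ⟨u, x, hu, h⟩ := h
  ⟨u, x, fun t => hS (hu t), h⟩

theorem Steers.trans {f : ℝ → M → M} {S : Set ℝ} {T T' : ℝ} {p q r : M} (hT : 0 ≤ T)
    (hT' : 0 ≤ T') (h : Steers f S T p q) (h' : Steers f S T' q r) :
    Steers f S (T + T') p r := by
  obtain ⟨u, x, hu, hu', hx, hx0, hxT⟩ := h
  obtain ⟨w, y, hw, hw', hy, hy0, hyT⟩ := h'
  have hxy : x T = y 0 := by rw [hxT, hy0]
  refine ⟨concatAt T u w, concatAt T x y, fun t => ?_, hu'.concatAt hw', hx.concatAt hT hy hxy,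
    ?_, ?_⟩
  · unfold concatAt
    split_ifs
    exacts [hu _, hw _]
  · rcases hT.eq_or_lt with rfl | h
    · rw [concatAt_of_le _ _ le_rfl, sub_zero, ← hxy, hx0]
    · rw [concatAt_of_lt _ _ h, hx0]
  · rw [concatAt_of_le _ _ (by linarith), add_sub_cancel_left, hyT]

theorem posOrbit_trans {f : ℝ → M → M} {S : Set ℝ} {p q r : M} (h : q ∈ PosOrbit f S p)
    (h' : r ∈ PosOrbit f S q) : r ∈ PosOrbit f S p := by
  obtain ⟨T, hT, h⟩ := mem_posOrbit_iff.1 h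
  obtain ⟨T', hT', h'⟩ := mem_posOrbit_iff.1 h'
  exact mem_posOrbit_iff.2 ⟨T + T', add_nonneg hT hT', h.trans hT hT' h'⟩

theorem closure_posOrbit_subset {f : ℝ → M → M} {S : Set ℝ} {p q : M}
    (h : q ∈ PosOrbit f S p) : closure (PosOrbit f S q) ⊆ closure (PosOrbit f S p) :=
  closure_mono fun _ hr => posOrbit_trans h hr

/-- Two sets with the defining properties of a control set can be merged when each is
approximately reachable from the other. -/
theorem ControlSetProp.union {f : ℝ → M → M} {S : Set ℝ} {C D : Set M}
    (hC : ControlSetProp f S C) (hD : ControlSetProp f S D)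
    (hCD : ∀ p ∈ C, D ⊆ closure (PosOrbit f S p))
    (hDC : ∀ p ∈ D, C ⊆ closure (PosOrbit f S p)) : ControlSetProp f S (C ∪ D) := by
  refine ⟨hC.1.inl, ?_, ?_⟩
  · rintro p (hp | hp)
    · obtain ⟨u, x, hu, hx, h0, h⟩ := hC.2.1 p hp
      exact ⟨u, x, hu, hx, h0, fun t ht => Or.inl (h t ht)⟩
    · obtain ⟨u, x, hu, hx, h0, h⟩ := hD.2.1 p hp
      exact ⟨u, x, hu, hx, h0, fun t ht => Or.inr (h t ht)⟩
  · rintro p (hp | hp)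
    · exact union_subset (hC.2.2 p hp) (hCD p hp)
    · exact union_subset (hDC p hp) (hD.2.2 p hp)

end Steering

section Planar

variable {A : Matrix (Fin 2) (Fin 2) ℝ} {ζ : V2}

theorem planF_lincomb (c d a b : ℝ) (v w : V2) :
    planF A ζ (c * a + d * b) (c • v + d • w) = c • planF A ζ a v + d • planF A ζ b w := by
  simp only [planF, mulVec_add, mulVec_smul]
  module

theorem Steers.lincomb {S S' S'' : Set ℝ} {T : ℝ} {v w v' w' : V2} (c d : ℝ)
    (h : Steers (planF A ζ) S T v w) (h' : Steers (planF A ζ) S' T v' w')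
    (hS : ∀ a ∈ S, ∀ b ∈ S', c * a + d * b ∈ S'') :
    Steers (planF A ζ) S'' T (c • v + d • v') (c • w + d • w') := by
  obtain ⟨u, x, hu, hu', hx, hx0, hxT⟩ := h
  obtain ⟨r, y, hr, hr', hy, hy0, hyT⟩ := h'
  refine ⟨fun t => c * u t + d * r t, fun t => c • x t + d • y t, fun t => hS _ (hu t) _ (hr t),
    hu'.lincomb hr' c d, ⟨(hx.1.const_smul c).add (hy.1.const_smul d), fun t ht => ?_⟩,
    by simp only [hx0, hy0], by simp only [hxT, hyT]⟩
  rw [planF_lincomb]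
  exact ((hx.2 t ht).const_smul c).add ((hy.2 t ht).const_smul d)

variable (A ζ) in
/-- The planar system with the constant control value adjoined as a second coordinate. -/
def augmented : V2 × ℝ →L[ℝ] V2 × ℝ :=
  ((Matrix.toLin' A).toContinuousLinearMap ∘L ContinuousLinearMap.fst ℝ V2 ℝ +
    (ContinuousLinearMap.snd ℝ V2 ℝ).smulRight ζ).prod 0

theorem augmented_apply (p : V2 × ℝ) : augmented A ζ p = (planF A ζ p.2 p.1, 0) := by
  simp [augmented, planF]

variable (A ζ) in
/-- The flow of the augmented planar system. -/
def planarFlow (t : ℝ) : V2 × ℝ →L[ℝ] V2 × ℝ := NormedSpace.exp (t • augmented A ζ)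

theorem planarFlow_zero (p : V2 × ℝ) : planarFlow A ζ 0 p = p := by
  simp [planarFlow]

theorem hasDerivAt_planarFlow (p : V2 × ℝ) (t : ℝ) :
    HasDerivAt (fun s => planarFlow A ζ s p) (augmented A ζ (planarFlow A ζ t p)) t := by
  simpa [planarFlow] using
    (hasDerivAt_exp_smul_const' (𝕂 := ℝ) (augmented A ζ) t).clm_apply (hasDerivAt_const t p)

theorem planarFlow_snd (p : V2 × ℝ) (t : ℝ) : (planarFlow A ζ t p).2 = p.2 := by
  have h : ∀ s, HasDerivAt (fun s => (planarFlow A ζ s p).2) 0 s := fun s => by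
    have := (ContinuousLinearMap.snd ℝ V2 ℝ).hasFDerivAt.comp_hasDerivAt s
      (hasDerivAt_planarFlow (A := A) (ζ := ζ) p s)
    simpa [augmented_apply] using! this
  have := is_const_of_deriv_eq_zero (fun s => (h s).differentiableAt) (fun s => (h s).deriv) t 0
  simpa [planarFlow_zero] using! this

theorem hasDerivAt_planarFlow_fst (p : V2 × ℝ) (t : ℝ) :
    HasDerivAt (fun s => (planarFlow A ζ s p).1)
      (planF A ζ p.2 (planarFlow A ζ t p).1) t := by
  have := (ContinuousLinearMap.fst ℝ V2 ℝ).hasFDerivAt.comp_hasDerivAt t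
    (hasDerivAt_planarFlow (A := A) (ζ := ζ) p t)
  simpa [augmented_apply, planarFlow_snd] using! this

theorem steers_planarFlow (v : V2) (a T : ℝ) :
    Steers (planF A ζ) {a} T v (planarFlow A ζ T (v, a)).1 :=
  ⟨fun _ => a, fun t => (planarFlow A ζ t (v, a)).1, fun _ => rfl, .const a,
    ⟨fun t _ => (hasDerivAt_planarFlow_fst _ t).continuousAt.continuousWithinAt,
      fun t _ => (hasDerivAt_planarFlow_fst (v, a) t).hasDerivWithinAt⟩,
    by simp [planarFlow_zero], rfl⟩

theorem steers_zero_zero (T : ℝ) : Steers (planF A ζ) {0} T 0 0 := by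
  have h := steers_planarFlow (A := A) (ζ := ζ) 0 0 T
  rwa [show ((0 : V2), (0 : ℝ)) = 0 from rfl, map_zero, Prod.fst_zero] at h

theorem eq_zero_of_hasDerivAt_of_eqOn_Ici {g : ℝ → ℝ} {g' t : ℝ} (h : HasDerivAt g g' t)
    (h0 : ∀ s, t ≤ s → g s = 0) : g' = 0 :=
  (uniqueDiffWithinAt_Ici t).eq_deriv _ h.hasDerivWithinAt
    ((hasDerivWithinAt_const t (Ici t) (0 : ℝ)).congr (fun s hs => h0 s hs) (h0 t le_rfl))

theorem HasDerivAt.omega2_left {x : ℝ → V2} {x' : V2} {t : ℝ} (h : HasDerivAt x x' t) (w : V2) :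
    HasDerivAt (fun s => omega2 (x s) w) (omega2 x' w) t := by
  have h' := hasDerivAt_pi.1 h
  exact ((h' 0).mul_const _).sub ((h' 1).mul_const _)

theorem omega2_swap (v w : V2) : omega2 v w = -omega2 w v := by
  simp only [omega2]
  ring

/-- Under the rank condition, two states reached from the origin with unit control are
linearly independent. -/
theorem exists_omega2_planarFlow_ne_zero (hLARC : omega2 (A.mulVec ζ) ζ ≠ 0) :
    ∃ s t, 0 ≤ s ∧ s < t ∧
      omega2 (planarFlow A ζ s (0, 1)).1 (planarFlow A ζ t (0, 1)).1 ≠ 0 := by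
  by_contra! hcon
  set F : ℝ → V2 := fun t => (planarFlow A ζ t (0, 1)).1 with hF
  have hF0 : F 0 = 0 := by simp [hF, planarFlow_zero]
  have hd : ∀ t, HasDerivAt F (A.mulVec (F t) + ζ) t := fun t => by
    simpa [planF] using hasDerivAt_planarFlow_fst (A := A) (ζ := ζ) (0, 1) t
  have hall : ∀ s t, 0 ≤ s → 0 ≤ t → omega2 (F t) (F s) = 0 := fun s t hs ht => by
    rcases lt_trichotomy s t with h | rfl | h
    · rw [omega2_swap, hcon s t hs h, neg_zero]
    · simp only [omega2]
      ring
    · exact hcon t s ht h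
  have h1 : ∀ s, 0 ≤ s → omega2 (F s) ζ = 0 := fun s hs => by
    have := eq_zero_of_hasDerivAt_of_eqOn_Ici ((hd 0).omega2_left (F s)) fun t ht => hall s t hs ht
    rw [hF0, mulVec_zero, zero_add] at this
    rw [omega2_swap, this, neg_zero]
  have h2 : ∀ s, 0 ≤ s → omega2 (A.mulVec (F s)) ζ = 0 := fun s hs => by
    have := eq_zero_of_hasDerivAt_of_eqOn_Ici ((hd s).omega2_left ζ) fun t ht => h1 t (hs.trans ht)
    simp only [omega2, Pi.add_apply] at this ⊢
    linarith
  have h3 : HasDerivAt (fun s => A.mulVec (F s)) (A.mulVec (A.mulVec (F 0) + ζ)) 0 :=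
    (Matrix.toLin' A).toContinuousLinearMap.hasFDerivAt.comp_hasDerivAt 0 (hd 0)
  have h4 := eq_zero_of_hasDerivAt_of_eqOn_Ici (h3.omega2_left ζ) h2
  rw [hF0, mulVec_zero, zero_add] at h4
  exact hLARC h4

variable {u₁ u₂ : ℝ}

/-- From the origin one reaches a whole ball, at every sufficiently large time. -/
theorem exists_ball_steers (hLARC : omega2 (A.mulVec ζ) ζ ≠ 0) (h₁ : u₁ < 0) (h₂ : 0 < u₂) :
    ∃ T₀ ε, 0 ≤ T₀ ∧ 0 < ε ∧ ∀ T, T₀ ≤ T → ∀ w : V2, ‖w‖ < ε →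
      Steers (planF A ζ) (Icc u₁ u₂) T 0 w := by
  obtain ⟨s, t, hs, hst, hne⟩ := exists_omega2_planarFlow_ne_zero hLARC
  set p := (planarFlow A ζ s (0, 1)).1
  set q := (planarFlow A ζ t (0, 1)).1
  set m := min (-u₁) u₂
  have hm : 0 < m := lt_min (by linarith) h₂
  have hm1 : m ≤ -u₁ := min_le_left _ _
  have hm2 : m ≤ u₂ := min_le_right _ _
  have hopen : ∀ᶠ w : V2 in 𝓝 0,
      |omega2 w q / omega2 p q| < m / 2 ∧ |omega2 p w / omega2 p q| < m / 2 := by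
    have hca : Continuous fun w : V2 => |omega2 w q / omega2 p q| := by
      unfold omega2
      fun_prop
    have hcb : Continuous fun w : V2 => |omega2 p w / omega2 p q| := by
      unfold omega2
      fun_prop
    refine (hca.continuousAt.eventually_lt continuousAt_const ?_).and
      (hcb.continuousAt.eventually_lt continuousAt_const ?_) <;>
    · simp only [omega2, Pi.zero_apply, zero_mul, mul_zero, sub_self, zero_div, abs_zero]
      linarith
  obtain ⟨ε, hε, hball⟩ := Metric.eventually_nhds_iff_ball.1 hopen
  refine ⟨t, ε, hs.trans hst.le, hε, fun T hT w hw => ?_⟩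
  obtain ⟨ha, hb⟩ := hball w (by simpa using hw)
  set a := omega2 w q / omega2 p q
  set b := omega2 p w / omega2 p q
  have hw : a • p + b • q = w := by
    ext i
    simp only [a, b, Pi.add_apply, Pi.smul_apply, smul_eq_mul]
    rw [div_mul_eq_mul_div, div_mul_eq_mul_div, ← add_div, div_eq_iff hne]
    fin_cases i <;> simp only [omega2, Fin.zero_eta, Fin.mk_one] <;> ring
  have hp : Steers (planF A ζ) (Icc 0 1) t 0 p := by
    have := ((steers_zero_zero (A := A) (ζ := ζ) (t - s)).mono
      (by simp : ({0} : Set ℝ) ⊆ Icc 0 1)).trans (sub_nonneg.2 hst.le) hs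
      ((steers_planarFlow 0 1 s).mono (by simp : ({1} : Set ℝ) ⊆ Icc 0 1))
    rwa [sub_add_cancel] at this
  have hw' := hp.lincomb (S'' := Icc u₁ u₂) a b (steers_planarFlow 0 1 t) fun c hc d hd => by
    obtain ⟨a1, a2⟩ := abs_lt.1 ha
    obtain ⟨b1, b2⟩ := abs_lt.1 hb
    obtain rfl : d = 1 := hd
    have := hc.1
    have := hc.2
    constructor <;> nlinarith
  rw [smul_zero, smul_zero, add_zero, hw] at hw'
  have := ((steers_zero_zero (A := A) (ζ := ζ) (T - t)).mono
    (by simp [h₁.le, h₂.le] : ({0} : Set ℝ) ⊆ Icc u₁ u₂)).trans (sub_nonneg.2 hT)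
    (hs.trans hst.le) hw'
  rwa [sub_add_cancel] at this

/-- If the planar system steers `d` to a whole ball around `d` in a fixed time, then it
steers all states near `d` to `d`. -/
theorem eventually_mem_posOrbit {d : V2} {T r : ℝ} (hT : 0 ≤ T) (hr : 0 < r)
    (h : ∀ w, ‖w - d‖ < r → Steers (planF A ζ) (Icc u₁ u₂) T d w) :
    ∀ᶠ y in 𝓝 d, d ∈ PosOrbit (planF A ζ) (Icc u₁ u₂) y := by
  have hc : Continuous fun y : V2 => ‖(planarFlow A ζ T (y - d, 0)).1‖ := by fun_prop
  have h0 : ‖(planarFlow A ζ T (d - d, 0)).1‖ < r := by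
    rwa [sub_self, show ((0 : V2), (0 : ℝ)) = 0 from rfl, map_zero, Prod.fst_zero, norm_zero]
  filter_upwards [hc.continuousAt.eventually_lt continuousAt_const h0] with y hy
  have h1 := (h (d - (planarFlow A ζ T (y - d, 0)).1) (by
    rwa [sub_sub_cancel_left, norm_neg])).lincomb (S'' := Icc u₁ u₂) 1 1
    (steers_planarFlow (y - d) 0 T) fun a ha b hb => by
      obtain rfl : b = 0 := hb
      simpa using ha
  rw [one_smul, one_smul, one_smul, one_smul, sub_add_cancel, add_sub_cancel] at h1
  exact mem_posOrbit_iff.2 ⟨T, hT, h1⟩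

theorem eventually_zero_mem_posOrbit (hLARC : omega2 (A.mulVec ζ) ζ ≠ 0) (h₁ : u₁ < 0)
    (h₂ : 0 < u₂) : ∀ᶠ y in 𝓝 (0 : V2), 0 ∈ PosOrbit (planF A ζ) (Icc u₁ u₂) y := by
  obtain ⟨T, ε, hT, hε, h⟩ := exists_ball_steers hLARC h₁ h₂
  exact eventually_mem_posOrbit hT hε fun w hw => h T le_rfl w (by simpa using hw)

theorem ControlSetProp.exists_steers_near {M : Type*} [NormedAddCommGroup M] [NormedSpace ℝ M]
    {f : ℝ → M → M} {S : Set ℝ} {D : Set M} (hD : ControlSetProp f S D) {x : M} (hx : x ∈ D)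
    {T₀ ρ : ℝ} (hT₀ : 0 ≤ T₀) (hρ : 0 < ρ) :
    ∃ T y, T₀ ≤ T ∧ ‖y - x‖ < ρ ∧ Steers f S T x y := by
  obtain ⟨u, γ, hu, hγ, h0, hstay⟩ := hD.2.1 x hx
  obtain ⟨y, hy, hyx⟩ := Metric.mem_closure_iff.1 (hD.2.2 _ (hstay T₀ hT₀) hx) ρ hρ
  obtain ⟨T, hT, h⟩ := mem_posOrbit_iff.1 hy
  refine ⟨T₀ + T, y, by linarith, by rwa [← dist_eq_norm, dist_comm], ?_⟩
  exact Steers.trans hT₀ hT ⟨u, γ, hu.1, hu.2.locally, hγ, h0, rfl⟩ h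

/-- A planar set with the control set properties and nonempty interior contains a state which
is reachable from the origin, and from all nearby states of which the origin is reachable. -/
theorem ControlSetProp.exists_mem_connected_zero (hLARC : omega2 (A.mulVec ζ) ζ ≠ 0)
    (h₁ : u₁ < 0) (h₂ : 0 < u₂) {D : Set V2} (hD : ControlSetProp (planF A ζ) (Icc u₁ u₂) D)
    (hint : (interior D).Nonempty) :
    ∃ d ∈ D, d ∈ PosOrbit (planF A ζ) (Icc u₁ u₂) 0 ∧
      ∀ᶠ y in 𝓝 d, 0 ∈ PosOrbit (planF A ζ) (Icc u₁ u₂) y := by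
  obtain ⟨T₀, ε, hT₀, hε, hball⟩ := exists_ball_steers hLARC h₁ h₂
  obtain ⟨x, hx⟩ := hint
  obtain ⟨l, hl0, hl1, hlD⟩ : ∃ l : ℝ, 0 < l ∧ l < 1 ∧ l • x ∈ D := by
    have hc : Tendsto (fun l : ℝ => l • x) (𝓝[<] 1) (𝓝 x) := by
      have : Continuous fun l : ℝ => l • x := by fun_prop
      simpa using (this.tendsto 1).mono_left nhdsWithin_le_nhds
    obtain ⟨l, hl, hl'⟩ := ((hc.eventually (mem_interior_iff_mem_nhds.1 hx)).and
      (Ioo_mem_nhdsLT (zero_lt_one' ℝ))).exists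
    exact ⟨l, hl'.1, hl'.2, hl⟩
  set r := (1 - l) * ε / 2 with hr
  have hr0 : 0 < r := by
    have := mul_pos (sub_pos.2 hl1) hε
    linarith
  obtain ⟨T, y, hT, hy, hxy⟩ := hD.exists_steers_near (interior_subset hx) hT₀ hr0
  have hloop : ∀ k, 0 ≤ k → k ≤ l → ∀ w, ‖w - k • x‖ < r →
      Steers (planF A ζ) (Icc u₁ u₂) T (k • x) w := fun k hk0 hkl w hw => by
    have hk1 : 0 < 1 - k := by linarith
    have hnorm : ‖w - k • y‖ < (1 - k) * ε := by
      calc ‖w - k • y‖ = ‖(w - k • x) - k • (y - x)‖ := by congr 1; module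
        _ ≤ ‖w - k • x‖ + ‖k • (y - x)‖ := norm_sub_le _ _
        _ < r + r := by
          refine add_lt_add_of_lt_of_le hw ?_
          rw [norm_smul, Real.norm_of_nonneg hk0]
          nlinarith [norm_nonneg (y - x)]
        _ = (1 - l) * ε := by rw [hr]; ring
        _ ≤ (1 - k) * ε := by gcongr
    have hb := hball T hT ((1 - k)⁻¹ • (w - k • y)) (by
      rwa [norm_smul, norm_inv, Real.norm_of_nonneg hk1.le, inv_mul_lt_iff₀ hk1])
    have := hxy.lincomb (S'' := Icc u₁ u₂) k (1 - k) hb fun a ha b hb =>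
      convex_Icc u₁ u₂ ha hb hk0 hk1.le (by ring)
    rwa [smul_zero, add_zero, smul_inv_smul₀ hk1.ne', add_sub_cancel] at this
  obtain ⟨N, hN⟩ := exists_nat_gt (‖l • x‖ / r)
  have hN0 : (0 : ℝ) < N := (div_nonneg (norm_nonneg _) hr0.le).trans_lt hN
  have hstep : ∀ k : ℕ, k < N →
      ((k + 1 : ℕ) * (l / N)) • x ∈ PosOrbit (planF A ζ) (Icc u₁ u₂) ((k * (l / N)) • x) ∧
      (k * (l / N)) • x ∈ PosOrbit (planF A ζ) (Icc u₁ u₂) (((k + 1 : ℕ) * (l / N)) • x) := by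
    intro k hk
    have hkN : ((k + 1 : ℕ) : ℝ) ≤ N := by exact_mod_cast hk
    have hle : ∀ j : ℝ, j ≤ N → j * (l / N) ≤ l := fun j hj => by
      rw [mul_div_assoc', div_le_iff₀ hN0, mul_comm]
      gcongr
    have hsmall : ‖(l / N) • x‖ < r := by
      rw [div_eq_inv_mul, mul_smul, norm_smul, norm_inv, Real.norm_of_nonneg hN0.le,
        inv_mul_lt_iff₀ hN0]
      rwa [div_lt_iff₀ hr0] at hN
    have hT' : 0 ≤ T := hT₀.trans hT
    have hdiff : ((k + 1 : ℕ) * (l / N)) • x - (k * (l / N)) • x = (l / N) • x := by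
      push_cast
      module
    constructor
    · refine mem_posOrbit_iff.2 ⟨T, hT', hloop _ (by positivity) (hle _ ?_) _ ?_⟩
      · push_cast at hkN
        linarith
      · rwa [hdiff]
    · refine mem_posOrbit_iff.2 ⟨T, hT', hloop _ (by positivity) (hle _ hkN) _ ?_⟩
      rwa [norm_sub_rev, hdiff]
  have hself : ∀ p : V2, p ∈ PosOrbit (planF A ζ) (Icc u₁ u₂) p := fun p =>
    mem_posOrbit_iff.2 ⟨0, le_rfl, by
      simpa [planarFlow_zero] using (steers_planarFlow (A := A) (ζ := ζ) p 0 0).mono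
        (by simp [h₁.le, h₂.le] : ({0} : Set ℝ) ⊆ Icc u₁ u₂)⟩
  have hchain : ∀ k : ℕ, k ≤ N →
      (k * (l / N)) • x ∈ PosOrbit (planF A ζ) (Icc u₁ u₂) 0 ∧
      0 ∈ PosOrbit (planF A ζ) (Icc u₁ u₂) ((k * (l / N)) • x) := by
    intro k
    induction k with
    | zero => simpa using hself 0
    | succ k ih =>
      intro hk
      obtain ⟨h3, h4⟩ := ih (by omega)
      obtain ⟨h5, h6⟩ := hstep k (by omega)
      exact ⟨posOrbit_trans h3 h5, posOrbit_trans h6 h4⟩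
  obtain ⟨h3, h4⟩ := hchain N le_rfl
  rw [mul_div_cancel₀ _ hN0.ne'] at h3 h4
  refine ⟨l • x, hlD, h3, ?_⟩
  filter_upwards [eventually_mem_posOrbit (hT₀.trans hT) hr0 (hloop l hl0.le le_rfl)] with z hz
  exact posOrbit_trans hz h4

/-- Every state of a set with the control set properties is steered to any state `q`
which is reachable from a neighbourhood of some state of the set. -/
theorem ControlSetProp.mem_posOrbit_of_eventually {M : Type*} [NormedAddCommGroup M]
    [NormedSpace ℝ M] {f : ℝ → M → M} {S : Set ℝ} {D : Set M} (hD : ControlSetProp f S D)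
    {p d q : M} (hp : p ∈ D) (hd : d ∈ D) (h : ∀ᶠ y in 𝓝 d, q ∈ PosOrbit f S y) :
    q ∈ PosOrbit f S p := by
  obtain ⟨y, hy, hy'⟩ := mem_closure_iff_nhds.1 (hD.2.2 p hp hd) _ h
  exact posOrbit_trans hy' hy

end Planar

section Lifting

open MeasureTheory

/-- Variation of constants for a scalar linear equation with right-continuous forcing term and
prescribed value at time `T`. -/
theorem exists_scalar_solution {g : ℝ → ℝ} (c : ℝ)
    (hint : ∀ t, 0 ≤ t → IntervalIntegrable g volume 0 t)
    (hcont : ∀ t, 0 ≤ t → ContinuousWithinAt g (Ici t) t) (T y : ℝ) :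
    ∃ z : ℝ → ℝ, ContinuousOn z (Ici 0) ∧
      (∀ t, 0 ≤ t → HasDerivWithinAt z (c * z t + g t) (Ici t) t) ∧ z T = y := by
  set h : ℝ → ℝ := fun s => Real.exp (-(c * s)) * g s
  have hh : ∀ t, 0 ≤ t → IntervalIntegrable h volume 0 t := fun t ht =>
    (hint t ht).continuousOn_mul (by fun_prop)
  set H : ℝ → ℝ := fun t => ∫ s in (0 : ℝ)..t, h s
  have hHc : ContinuousOn H (Ici 0) := fun t ht => by
    have ht' : (0 : ℝ) ≤ t + 1 := by
      have := mem_Ici.1 ht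
      linarith
    have h1 := intervalIntegral.continuousOn_primitive_interval' (hh (t + 1) ht') left_mem_uIcc
    rw [uIcc_of_le ht'] at h1
    refine (h1 t ⟨ht, by linarith⟩).mono_of_mem_nhdsWithin ?_
    rw [← Ici_inter_Iic]
    exact inter_mem self_mem_nhdsWithin (mem_nhdsWithin_of_mem_nhds (Iic_mem_nhds (by linarith)))
  have hHd : ∀ t, 0 ≤ t → HasDerivWithinAt H (h t) (Ici t) t := fun t ht => by
    refine intervalIntegral.integral_hasDerivWithinAt_right (hh t ht)
      (t := Ioi t) ⟨Ioc t (t + 1), Ioc_mem_nhdsGT (by linarith), ?_⟩ ?_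
    · have h1 := (hh (t + 1) (by linarith)).1.aestronglyMeasurable
      exact h1.mono_set (Ioc_subset_Ioc_left ht)
    · refine ContinuousWithinAt.mono ?_ Ioi_subset_Ici_self
      exact ContinuousWithinAt.mul (by fun_prop) (hcont t ht)
  refine ⟨fun t => Real.exp (c * t) * (Real.exp (-(c * T)) * y - H T + H t), ?_, ?_, ?_⟩
  · exact ContinuousOn.mul (by fun_prop) (continuousOn_const.add hHc)
  · intro t ht
    have he : HasDerivAt (fun s => Real.exp (c * s)) (Real.exp (c * t) * c) t := by
      simpa using ((hasDerivAt_id t).const_mul c).exp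
    refine (he.hasDerivWithinAt.mul ((hHd t ht).const_add _)).congr_deriv ?_
    have : Real.exp (c * t) * Real.exp (-(c * t)) = 1 := by
      rw [← Real.exp_add, add_neg_cancel, Real.exp_zero]
    simp only [h]
    linear_combination g t * this
  · have : Real.exp (c * T) * Real.exp (-(c * T)) = 1 := by
      rw [← Real.exp_add, add_neg_cancel, Real.exp_zero]
    linear_combination y * this

/-- A continuous function of time and of a piecewise constant control is integrable on compact
time intervals. -/
theorem PiecewiseConst.intervalIntegrable {u : ℝ → ℝ} (hu : PiecewiseConst u) {G : ℝ → ℝ → ℝ}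
    (hG : ∀ a, ContinuousOn (G a) (Ici 0)) {t : ℝ} (ht : 0 ≤ t) :
    IntervalIntegrable (fun s => G (u s) s) volume 0 t := by
  obtain ⟨n, τ, h0, hτ, hn, hc⟩ := hu t ht
  have hpiece : IntervalIntegrable (fun s => G (u s) s) volume (τ 0) (τ n) := by
    refine IntervalIntegrable.trans_iterate fun k hk => ?_
    have hle := (hτ (Nat.lt_succ_self k)).le
    have h1 : IntervalIntegrable (G (u (τ k))) volume (τ k) (τ (k + 1)) := by
      refine ((hG _).mono fun s hs => ?_).intervalIntegrable
      rw [uIcc_of_le hle] at hs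
      exact (h0 ▸ hτ.monotone (Nat.zero_le k)).trans hs.1
    refine h1.congr_uIoo fun s hs => ?_
    rw [uIoo_of_le hle] at hs
    simp only [hc k hk s ⟨hs.1.le, hs.2⟩]
  rw [h0] at hpiece
  refine hpiece.mono_set ?_
  rw [uIcc_of_le ht, uIcc_of_le (ht.trans hn)]
  exact Icc_subset_Icc_right hn

variable {A : Matrix (Fin 2) (Fin 2) ℝ} {η ζ : V2} {α : ℝ}

/-- A planar trajectory lifts to a trajectory on the Heisenberg group with prescribed height at
time `T`. -/
theorem IsTraj.exists_lift {u : ℝ → ℝ} {x : ℝ → V2} (hu : PiecewiseConst u)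
    (hx : IsTraj (planF A ζ) u x) (T y : ℝ) :
    ∃ z : ℝ → ℝ, IsTraj (heisF A η ζ α) u (fun t => (x t, z t)) ∧ z T = y := by
  set G : ℝ → ℝ → ℝ := fun a s => a * α + omega2 (x s) (theta η + (a / 2) • ζ) with hGdef
  have hG : ∀ a, ContinuousOn (G a) (Ici 0) := fun a => by
    have hi : ∀ i, ContinuousOn (fun s => x s i) (Ici 0) := continuousOn_pi.1 hx.1
    exact continuousOn_const.add
      (((hi 0).mul continuousOn_const).sub ((hi 1).mul continuousOn_const))
  obtain ⟨z, hz, hz', hzT⟩ := exists_scalar_solution (g := fun s => G (u s) s) A.trace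
    (fun t ht => hu.intervalIntegrable hG ht) (fun t ht => by
      refine ((hG (u t) t ht).mono (Ici_subset_Ici.2 ht)).congr_of_eventuallyEq ?_ rfl
      filter_upwards [hu.locally.1 t ht] with s hs
      rw [hs]) T y
  refine ⟨z, ⟨hx.1.prodMk hz, fun t ht => ?_⟩, hzT⟩
  refine ((hx.2 t ht).prodMk (hz' t ht)).congr_deriv ?_
  simp only [heisF, planF, hGdef, add_assoc]

theorem IsTraj.fst {u : ℝ → ℝ} {x : ℝ → V2 × ℝ} (hx : IsTraj (heisF A η ζ α) u x) :
    IsTraj (planF A ζ) u fun t => (x t).1 :=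
  ⟨continuous_fst.comp_continuousOn hx.1, fun t ht =>
    (ContinuousLinearMap.fst ℝ V2 ℝ).hasFDerivAt.comp_hasDerivWithinAt t (hx.2 t ht)⟩

theorem fst_mem_posOrbit {S : Set ℝ} {p q : V2 × ℝ} (h : q ∈ PosOrbit (heisF A η ζ α) S p) :
    q.1 ∈ PosOrbit (planF A ζ) S p.1 := by
  obtain ⟨u, x, T, hu, hx, rfl, hT, rfl⟩ := h
  exact ⟨u, _, T, hu, hx.fst, rfl, hT, rfl⟩

theorem exists_mem_posOrbit_of_planar_start {S : Set ℝ} {v w : V2}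
    (h : w ∈ PosOrbit (planF A ζ) S v) (z : ℝ) :
    ∃ y, (w, y) ∈ PosOrbit (heisF A η ζ α) S (v, z) := by
  obtain ⟨u, x, T, hu, hx, rfl, hT, rfl⟩ := h
  obtain ⟨γ, hγ, rfl⟩ := hx.exists_lift (η := η) (α := α) hu.2 0 z
  exact ⟨γ T, u, _, T, hu, hγ, rfl, hT, rfl⟩

theorem exists_mem_posOrbit_of_planar_end {S : Set ℝ} {v w : V2}
    (h : w ∈ PosOrbit (planF A ζ) S v) (y : ℝ) :
    ∃ z, (w, y) ∈ PosOrbit (heisF A η ζ α) S (v, z) := by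
  obtain ⟨u, x, T, hu, hx, rfl, hT, rfl⟩ := h
  obtain ⟨γ, hγ, rfl⟩ := hx.exists_lift (η := η) (α := α) hu.2 T y
  exact ⟨γ 0, u, _, T, hu, hγ, rfl, hT, rfl⟩

theorem ControlSetProp.image_fst {S : Set ℝ} {C : Set (V2 × ℝ)}
    (hC : ControlSetProp (heisF A η ζ α) S C) :
    ControlSetProp (planF A ζ) S (Prod.fst '' C) := by
  refine ⟨hC.1.image _, ?_, ?_⟩
  · rintro _ ⟨p, hp, rfl⟩
    obtain ⟨u, x, hu, hx, rfl, h⟩ := hC.2.1 p hp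
    exact ⟨u, _, hu, hx.fst, rfl, fun t ht => mem_image_of_mem _ (h t ht)⟩
  · rintro _ ⟨p, hp, rfl⟩ _ ⟨q, hq, rfl⟩
    refine closure_mono ?_
      (image_closure_subset_closure_image continuous_fst (mem_image_of_mem _ (hC.2.2 p hp hq)))
    rintro _ ⟨r, hr, rfl⟩
    exact fst_mem_posOrbit hr

end Lifting

theorem ControlSetProp.prod_univ {A : Matrix (Fin 2) (Fin 2) ℝ} {η ζ : V2} {α u₁ u₂ : ℝ}
    (h₁ : u₁ < 0) (h₂ : 0 < u₂) (hLARC : omega2 (A.mulVec ζ) ζ ≠ 0)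
    (hfiber : ∀ z₁ z₂ : ℝ,
      ((0 : V2), z₂) ∈ PosOrbit (heisF A η ζ α) (Icc u₁ u₂) ((0 : V2), z₁))
    {C : Set V2} (hC : ControlSetProp (planF A ζ) (Icc u₁ u₂) C) (h0 : (0 : V2) ∈ C) :
    ControlSetProp (heisF A η ζ α) (Icc u₁ u₂) (C ×ˢ (univ : Set ℝ)) := by
  refine ⟨hC.1.prod univ_nonempty, ?_, ?_⟩
  · rintro ⟨v, z⟩ ⟨hv, -⟩
    obtain ⟨u, x, hu, hx, rfl, h⟩ := hC.2.1 v hv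
    obtain ⟨γ, hγ, rfl⟩ := hx.exists_lift (η := η) (α := α) hu.2 0 z
    exact ⟨u, _, hu, hγ, rfl, fun t ht => ⟨h t ht, mem_univ _⟩⟩
  · rintro ⟨v, z⟩ ⟨hv, -⟩ ⟨w, y⟩ ⟨hw, -⟩
    obtain ⟨z₁, hz₁⟩ := exists_mem_posOrbit_of_planar_start (η := η) (α := α)
      (hC.mem_posOrbit_of_eventually hv h0 (eventually_zero_mem_posOrbit hLARC h₁ h₂)) z
    refine Metric.mem_closure_iff.2 fun ε hε => ?_
    obtain ⟨w', hw', hd⟩ := Metric.mem_closure_iff.1 (hC.2.2 0 h0 hw) ε hε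
    obtain ⟨z₂, hz₂⟩ := exists_mem_posOrbit_of_planar_end (η := η) (α := α) hw' y
    exact ⟨(w', y), posOrbit_trans hz₁ (posOrbit_trans (hfiber z₁ z₂) hz₂), by
      simpa [Prod.dist_eq] using hd⟩

/-- A planar control set containing the origin contains every set with the control set
properties and nonempty interior. -/
theorem IsControlSet.subset_of_interior_nonempty {A : Matrix (Fin 2) (Fin 2) ℝ} {ζ : V2}
    {u₁ u₂ : ℝ} (h₁ : u₁ < 0) (h₂ : 0 < u₂) (hLARC : omega2 (A.mulVec ζ) ζ ≠ 0)
    {C D : Set V2} (hC : IsControlSet (planF A ζ) (Icc u₁ u₂) C) (h0 : (0 : V2) ∈ C)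
    (hD : ControlSetProp (planF A ζ) (Icc u₁ u₂) D) (hint : (interior D).Nonempty) :
    D ⊆ C := by
  obtain ⟨d, hdD, hd, hd'⟩ := hD.exists_mem_connected_zero hLARC h₁ h₂ hint
  have hunion : ControlSetProp (planF A ζ) (Icc u₁ u₂) (C ∪ D) := by
    refine hC.1.union hD (fun p hp => ?_) fun p hp => ?_
    · have hp0 := hC.1.mem_posOrbit_of_eventually hp h0 (eventually_zero_mem_posOrbit hLARC h₁ h₂)
      exact (hD.2.2 d hdD).trans (closure_posOrbit_subset (posOrbit_trans hp0 hd))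
    · exact (hC.1.2.2 0 h0).trans
        (closure_posOrbit_subset (hD.mem_posOrbit_of_eventually hp hdD hd'))
  rw [hC.2 _ hunion subset_union_left]
  exact subset_union_right

/-- if the LARC `ω(Aζ,ζ) ≠ 0` holds, the fiber `{0} × ℝ` is
controllable for `Σ_ℍ`, and `C₂` is a control set of the planar system
`v̇ = Av + uζ` with `0 ∈ int C₂`, then `C₂ × ℝ` is the unique control set of
`Σ_ℍ` with nonempty interior. -/
theorem stmt8 (A : Matrix (Fin 2) (Fin 2) ℝ) (η ζ : V2) (α u₁ u₂ : ℝ)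
    (h₁ : u₁ < 0) (h₂ : 0 < u₂)
    (hLARC : omega2 (A.mulVec ζ) ζ ≠ 0)
    (hfiber : ∀ z₁ z₂ : ℝ,
      (((0 : V2), z₂) : V2 × ℝ) ∈
        PosOrbit (heisF A η ζ α) (Icc u₁ u₂) (((0 : V2), z₁) : V2 × ℝ))
    (C₂ : Set V2) (hC₂ : IsControlSet (planF A ζ) (Icc u₁ u₂) C₂)
    (h0 : (0 : V2) ∈ interior C₂) :
    IsControlSet (heisF A η ζ α) (Icc u₁ u₂) (C₂ ×ˢ (univ : Set ℝ)) ∧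
    ∀ C : Set (V2 × ℝ), IsControlSet (heisF A η ζ α) (Icc u₁ u₂) C →
      (interior C).Nonempty → C = C₂ ×ˢ (univ : Set ℝ) := by
  have h0C : (0 : V2) ∈ C₂ := interior_subset h0
  have hprod := hC₂.1.prod_univ h₁ h₂ hLARC hfiber h0C
  have hsub : ∀ C : Set (V2 × ℝ), ControlSetProp (heisF A η ζ α) (Icc u₁ u₂) C →
      (interior C).Nonempty → C ⊆ C₂ ×ˢ (univ : Set ℝ) := fun C hC hint p hp => by
    refine ⟨hC₂.subset_of_interior_nonempty h₁ h₂ hLARC h0C hC.image_fst ?_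
      (mem_image_of_mem _ hp), mem_univ _⟩
    exact (hint.image Prod.fst).mono (isOpenMap_fst.image_interior_subset C)
  refine ⟨⟨hprod, fun C hC hle => hle.antisymm (hsub C hC ?_)⟩, fun C hC hint =>
    hC.2 _ hprod (hsub C hC.1 hint)⟩
  refine Nonempty.mono (interior_mono hle) ⟨((0 : V2), (0 : ℝ)), ?_⟩
  rw [interior_prod_eq, interior_univ]
  exact ⟨h0, mem_univ _⟩
end
end
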